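/- arXiv:2504.11382 — 11 statements merged into one kernel-verified Lean document; each statement's English description precedes it below -/
import Mathlib

section
/- Let m, n, r ∈ ℕ with r < min(m, n), let X ∈ ℝ^{m×n} with rank X ≤ r, and set r̲ = rank X. Let U_⊥ ∈ ℝ^{m×(m−r̲)} and V_⊥ ∈ ℝ^{n×(n−r̲)} have orthonormal columns with the column space of U_⊥ equal to the orthogonal complement of the column space of X and the column space of V_⊥ equal to the orthogonal complement of the column space of Xᵀ. Then the tangent cone to ℝ_{≤r}^{m×n} at X equals {Z ∈ ℝ^{m×n} : rank(U_⊥ᵀ Z V_⊥) ≤ r − r̲}. -/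
open Matrix
/-- The column space of a real matrix, as a submodule of Euclidean space. -/
noncomputable def colSpace {m n : ℕ} (A : Matrix (Fin m) (Fin n) ℝ) :
    Submodule ℝ (EuclideanSpace ℝ (Fin m)) :=
  LinearMap.range (Matrix.toEuclideanLin A)

/-- The (Bouligand/sequential) tangent cone to a set of matrices at a point. -/
def seqTangentCone {m n : ℕ} (S : Set (Matrix (Fin m) (Fin n) ℝ))
    (X : Matrix (Fin m) (Fin n) ℝ) : Set (Matrix (Fin m) (Fin n) ℝ) :=
  {Z | ∃ (Y : ℕ → Matrix (Fin m) (Fin n) ℝ) (t : ℕ → ℝ),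
    (∀ i, Y i ∈ S) ∧ (∀ i, 0 < t i) ∧
    Filter.Tendsto Y Filter.atTop (nhds X) ∧
    Filter.Tendsto (fun i => (t i)⁻¹ • (Y i - X)) Filter.atTop (nhds Z)}

/-- The matrices of rank at most `r` form a closed set. -/
theorem isClosed_setOf_rank_le {α β : Type*} [Fintype α] [Fintype β] (r : ℕ) :
    IsClosed {M : Matrix α β ℝ | M.rank ≤ r} := by
  classical
  let φ : Matrix α β ℝ →ₗ[ℝ] ((β → ℝ) →L[ℝ] (α → ℝ)) :=
    (LinearMap.toContinuousLinearMap (𝕜 := ℝ) (E := β → ℝ) (F' := α → ℝ)).toLinearMap ∘ₗ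
      (Matrix.toLin' (R := ℝ) (m := α) (n := β)).toLinearMap
  have hφ : Continuous φ := φ.continuous_of_finiteDimensional
  rw [← isOpen_compl_iff]
  convert (isOpen_setOfPred_nat_le_rank (r + 1)).preimage hφ using 1
  ext M
  have hM : ((φ M : (β → ℝ) →L[ℝ] (α → ℝ)) : (β → ℝ) →ₗ[ℝ] (α → ℝ)).rank = (M.rank : Cardinal) := by
    rw [LinearMap.rank, ← Module.finrank_eq_rank]
    rfl
  rw [Set.mem_preimage, Set.mem_ofPred_eq, hM, Nat.cast_le]
  exact not_le (a := M.rank) (b := r)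

/-- If `j` is injective with `p ∘ j = 0`, then the dimensions of the image under `p` and of the
preimage under `j` of a subspace add up to at most its dimension. -/
theorem finrank_map_add_finrank_comap_le {K V A B : Type*} [Field K] [AddCommGroup V] [Module K V]
    [AddCommGroup A] [Module K A] [AddCommGroup B] [Module K B] [FiniteDimensional K V]
    (R : Submodule K V) (p : V →ₗ[K] A) (j : B →ₗ[K] V) (hj : Function.Injective j)
    (hpj : p ∘ₗ j = 0) :
    Module.finrank K (R.map p) + Module.finrank K (R.comap j) ≤ Module.finrank K R := by
  rw [← (p.domRestrict R).finrank_range_add_finrank_ker, LinearMap.range_domRestrict]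
  refine Nat.add_le_add_left ?_ _
  let f : R.comap j →ₗ[K] LinearMap.ker (p.domRestrict R) :=
    ((j.domRestrict (R.comap j)).codRestrict R fun b => b.2).codRestrict _ fun b =>
      LinearMap.congr_fun hpj b
  refine LinearMap.finrank_le_finrank_of_injective (f := f) fun a b h => ?_
  have hab : j a = j b := congrArg (fun v : LinearMap.ker (p.domRestrict R) => ((v : R) : V)) h
  exact Subtype.ext (hj hab)

theorem rank_add_rank_le_rank_fromBlocks_zero₁₂ {α β γ δ : Type*} [Fintype α] [Fintype β]
    [Fintype γ] [Fintype δ] (A : Matrix α γ ℝ) (C : Matrix β γ ℝ) (D : Matrix β δ ℝ) :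
    A.rank + D.rank ≤ (fromBlocks A 0 C D).rank := by
  let p : (α ⊕ β → ℝ) →ₗ[ℝ] (α → ℝ) := LinearMap.funLeft ℝ ℝ Sum.inl
  let j : (β → ℝ) →ₗ[ℝ] (α ⊕ β → ℝ) :=
    { toFun := fun y => Sum.elim 0 y
      map_add' := fun x y => by ext (i | i) <;> simp
      map_smul' := fun c x => by ext (i | i) <;> simp }
  have hj : Function.Injective j := fun x y h => funext fun i => congrFun h (Sum.inr i)
  have hpj : p ∘ₗ j = 0 := rfl
  refine le_trans ?_ (finrank_map_add_finrank_comap_le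
    (LinearMap.range (fromBlocks A 0 C D).mulVecLin) p j hj hpj)
  refine add_le_add (Submodule.finrank_mono ?_) (Submodule.finrank_mono ?_)
  · rintro _ ⟨x, rfl⟩
    refine ⟨_, ⟨Sum.elim x 0, rfl⟩, ?_⟩
    ext i
    simp [p, LinearMap.funLeft_apply, fromBlocks_mulVec]
  · rintro _ ⟨y, rfl⟩
    refine ⟨Sum.elim 0 y, ?_⟩
    ext (i | i) <;> simp [j, fromBlocks_mulVec]

theorem rank_add_le {α β : Type*} [Fintype α] [Fintype β] (A B : Matrix α β ℝ) :
    (A + B).rank ≤ A.rank + B.rank := by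
  have h : LinearMap.range (A + B).mulVecLin ≤
      LinearMap.range A.mulVecLin ⊔ LinearMap.range B.mulVecLin := by
    rw [mulVecLin_add]
    exact LinearMap.range_add_le _ _
  exact (Submodule.finrank_mono h).trans (Submodule.finrank_add_le_finrank_add_finrank _ _)

theorem transpose_mul_eq_zero_of_colSpace_eq_orthogonal {m n k : ℕ}
    {U : Matrix (Fin m) (Fin k) ℝ} {X : Matrix (Fin m) (Fin n) ℝ}
    (h : colSpace U = (colSpace X)ᗮ) : Uᵀ * X = 0 := by
  ext i j
  have hU : toEuclideanLin U (WithLp.toLp 2 (Pi.single i 1)) ∈ (colSpace X)ᗮ :=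
    h ▸ ⟨_, rfl⟩
  have := (Submodule.mem_orthogonal _ _).1 hU (toEuclideanLin X (WithLp.toLp 2 (Pi.single j 1)))
    ⟨_, rfl⟩
  simpa [EuclideanSpace.inner_eq_star_dotProduct, Matrix.mul_apply, dotProduct] using this

/-- If the columns of `U` are an orthonormal basis of the orthogonal complement of the column space
of `X`, then the orthogonal projector `1 - U * Uᵀ` factors through `X`. -/
theorem exists_mul_eq_one_sub_mul_transpose {m n k : ℕ}
    {U : Matrix (Fin m) (Fin k) ℝ} {X : Matrix (Fin m) (Fin n) ℝ} (hU : Uᵀ * U = 1)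
    (h : colSpace U = (colSpace X)ᗮ) : ∃ G : Matrix (Fin n) (Fin m) ℝ, X * G = 1 - U * Uᵀ := by
  have hz : Uᵀ * (1 - U * Uᵀ) = 0 := by
    rw [Matrix.mul_sub, ← Matrix.mul_assoc, hU, Matrix.mul_one, Matrix.one_mul, sub_self]
  have hmem : ∀ v, WithLp.toLp 2 ((1 - U * Uᵀ) *ᵥ v) ∈ colSpace X := by
    intro v
    rw [← (colSpace X).orthogonal_orthogonal, ← h, Submodule.mem_orthogonal]
    rintro _ ⟨y, rfl⟩
    rw [EuclideanSpace.inner_eq_star_dotProduct, star_trivial, ofLp_toLpLin, toLin'_apply,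
      dotProduct_mulVec, ← mulVec_transpose, mulVec_mulVec, hz, zero_mulVec, zero_dotProduct]
  choose g hg using fun j => hmem (Pi.single j 1)
  refine ⟨of fun i j => g j i, ?_⟩
  ext i j
  have := congrArg (fun v : EuclideanSpace ℝ (Fin m) => v i) (hg j)
  rw [mulVec_single_one] at this
  exact this

/-- description of the tangent cone to the real generic determinantal
variety `ℝ_{≤r}^{m×n}` at a point `X` of rank `r̲ = rank X`, via the matrices `U_⊥`, `V_⊥`
whose columns are orthonormal bases of `(im X)ᗮ` and `(im Xᵀ)ᗮ`. -/
theorem tangentCone_rank_le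
    {m n r : ℕ} (hr : r < min m n)
    (X : Matrix (Fin m) (Fin n) ℝ) (hX : X.rank ≤ r)
    (Uperp : Matrix (Fin m) (Fin (m - X.rank)) ℝ)
    (Vperp : Matrix (Fin n) (Fin (n - X.rank)) ℝ)
    (hUo : Uperpᵀ * Uperp = 1) (hVo : Vperpᵀ * Vperp = 1)
    (hUc : colSpace Uperp = (colSpace X)ᗮ)
    (hVc : colSpace Vperp = (colSpace Xᵀ)ᗮ) :
    seqTangentCone {Y : Matrix (Fin m) (Fin n) ℝ | Y.rank ≤ r} X
      = {Z : Matrix (Fin m) (Fin n) ℝ | (Uperpᵀ * Z * Vperp).rank ≤ r - X.rank} := by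
  have hUX : Uperpᵀ * X = 0 := transpose_mul_eq_zero_of_colSpace_eq_orthogonal hUc
  have hXV : X * Vperp = 0 := by
    simpa using congrArg transpose (transpose_mul_eq_zero_of_colSpace_eq_orthogonal hVc)
  ext Z
  constructor
  · rintro ⟨Y, t, hY, -, hYX, hYZ⟩
    have hlim : Filter.Tendsto
        (fun i => fromBlocks (Y i) (Y i * Vperp) (Uperpᵀ * ((t i)⁻¹ • (Y i - X)))
          (Uperpᵀ * ((t i)⁻¹ • (Y i - X)) * Vperp)) Filter.atTop
        (nhds (fromBlocks X 0 (Uperpᵀ * Z) (Uperpᵀ * Z * Vperp))) := by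
      have hc : Continuous fun W : Matrix (Fin m) (Fin n) ℝ × Matrix (Fin m) (Fin n) ℝ =>
          fromBlocks W.1 (W.1 * Vperp) (Uperpᵀ * W.2) (Uperpᵀ * W.2 * Vperp) := by
        fun_prop
      have := (hc.tendsto (X, Z)).comp (hYX.prodMk_nhds hYZ)
      simpa only [hXV, Function.comp_def] using this
    have hrank : (fromBlocks X 0 (Uperpᵀ * Z) (Uperpᵀ * Z * Vperp)).rank ≤ r := by
      refine (isClosed_setOf_rank_le r).mem_of_tendsto hlim (Filter.Eventually.of_forall fun i => ?_)
      have hfac : fromBlocks (Y i) (Y i * Vperp) (Uperpᵀ * ((t i)⁻¹ • (Y i - X)))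
          (Uperpᵀ * ((t i)⁻¹ • (Y i - X)) * Vperp) =
          fromRows 1 ((t i)⁻¹ • Uperpᵀ) * Y i * fromCols 1 Vperp := by
        rw [fromRows_mul, fromRows_mul_fromCols]
        simp [Matrix.mul_sub, hUX]
      rw [Set.mem_ofPred_eq, hfac]
      exact (rank_mul_le_left _ _).trans ((rank_mul_le_right _ _).trans (hY i))
    have := rank_add_rank_le_rank_fromBlocks_zero₁₂ X (Uperpᵀ * Z) (Uperpᵀ * Z * Vperp)
    rw [Set.mem_ofPred_eq]
    omega
  · intro hZ
    rw [Set.mem_ofPred_eq] at hZ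
    obtain ⟨G, hG⟩ := exists_mul_eq_one_sub_mul_transpose hUo hUc
    obtain ⟨H, hH⟩ := exists_mul_eq_one_sub_mul_transpose hVo hVc
    replace hH : Hᵀ * X = 1 - Vperp * Vperpᵀ := by
      simpa using congrArg transpose hH
    set N := Uperp * (Uperpᵀ * Z * Vperp) * Vperpᵀ with hN
    set A := Uperp * Uperpᵀ * Z * Hᵀ with hA
    set B := G * Z with hB
    have hsum : A * X + X * B + N = Z := by
      rw [hA, hB, hN, Matrix.mul_assoc _ Hᵀ, hH, ← Matrix.mul_assoc X, hG]
      simp only [Matrix.mul_sub, Matrix.sub_mul, Matrix.mul_one, Matrix.one_mul, Matrix.mul_assoc]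
      abel
    let s : ℕ → ℝ := fun i => 1 / ((i : ℝ) + 1)
    have hs : ∀ i, 0 < s i := fun i => by positivity
    have hs0 : Filter.Tendsto s Filter.atTop (nhds 0) := tendsto_one_div_add_atTop_nhds_zero_nat
    have hexp : ∀ c : ℝ, (1 + c • A) * X * (1 + c • B) + c • N =
        X + c • (Z + c • (A * X * B)) := by
      intro c
      rw [← hsum]
      simp only [Matrix.add_mul, Matrix.mul_add, Matrix.one_mul, Matrix.mul_one, Matrix.smul_mul,
        Matrix.mul_smul, smul_add]
      abel
    refine ⟨fun i => (1 + s i • A) * X * (1 + s i • B) + s i • N, s, fun i => ?_, hs, ?_, ?_⟩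
    · have h₁ : ((1 + s i • A) * X * (1 + s i • B)).rank ≤ X.rank :=
        (rank_mul_le_left _ _).trans (rank_mul_le_right _ _)
      have h₂ : (s i • N).rank ≤ r - X.rank := by
        rw [hN, ← Matrix.smul_mul, ← Matrix.smul_mul]
        exact (rank_mul_le_left _ _).trans ((rank_mul_le_right _ _).trans hZ)
      have := rank_add_le ((1 + s i • A) * X * (1 + s i • B)) (s i • N)
      exact this.trans (by omega)
    · have hc : Continuous fun c : ℝ => X + c • (Z + c • (A * X * B)) := by fun_prop
      simpa [hexp, Function.comp_def] using (hc.tendsto 0).comp hs0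
    · have hc : Continuous fun c : ℝ => Z + c • (A * X * B) := by fun_prop
      have := (hc.tendsto 0).comp hs0
      simpa [hexp, Function.comp_def, inv_smul_smul₀ (hs _).ne', -smul_add] using this
end

section
/- Let m, n, r ∈ ℕ with r < min(m, n), let X ∈ ℝ^{m×n} with rank X ≤ r, and set r̲ = rank X. Let U ∈ ℝ^{m×r̲}, U_⊥ ∈ ℝ^{m×(m−r̲)}, V ∈ ℝ^{n×r̲}, V_⊥ ∈ ℝ^{n×(n−r̲)} have orthonormal columns, with the column space of U equal to the column space of X, the column space of U_⊥ equal to its orthogonal complement, the column space of V equal to the column space of Xᵀ, and the column space of V_⊥ equal to its orthogonal complement. Then the tangent cone to ℝ_{≤r}^{m×n} at X equals { U A Vᵀ + U B V_⊥ᵀ + U_⊥ C Vᵀ + U_⊥ D V_⊥ᵀ : A ∈ ℝ^{r̲×r̲}, B ∈ ℝ^{r̲×(n−r̲)}, C ∈ ℝ^{(m−r̲)×r̲}, D ∈ ℝ^{(m−r̲)×(n−r̲)} with rank D ≤ r − r̲ }. -/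
open Matrix

open Filter Topology

namespace Matrix

section Rank

variable {K k l m n : Type*} [Field K] [Fintype n] [Fintype l]

theorem rank_add_le_add [Finite m] (A B : Matrix m n K) : (A + B).rank ≤ A.rank + B.rank := by
  unfold rank
  rw [mulVecLin_add]
  refine (Submodule.finrank_mono ?_).trans (Submodule.finrank_add_le_finrank_add_finrank _ _)
  exact LinearMap.range_add_le _ _

/-- The case `P * W * Q = 0` of the Frobenius rank inequality. -/
theorem rank_mul_add_rank_mul_le_of_mul_mul_eq_zero [Finite k] [Fintype m]
    (P : Matrix k m K) (W : Matrix m n K) (Q : Matrix n l K) (h : P * W * Q = 0) :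
    (P * W).rank + (W * Q).rank ≤ W.rank := by
  set g := P.mulVecLin.domRestrict W.mulVecLin.range with hg
  have hrange : (P * W).rank = Module.finrank K g.range := by
    rw [rank, mulVecLin_mul, LinearMap.range_comp, hg, LinearMap.range_domRestrict]
  have hle : (W * Q).mulVecLin.range ≤ W.mulVecLin.range := by
    rw [mulVecLin_mul]
    exact LinearMap.range_comp_le_range _ _
  have hker : (W * Q).rank ≤ Module.finrank K g.ker := by
    rw [rank, ← (Submodule.comapSubtypeEquivOfLe hle).finrank_eq]
    refine Submodule.finrank_mono ?_
    rintro ⟨_, _⟩ ⟨y, rfl⟩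
    simp [hg, mulVec_mulVec, ← Matrix.mul_assoc, h]
  rw [hrange]
  exact (Nat.add_le_add_left hker _).trans_eq g.finrank_range_add_finrank_ker

end Rank

theorem isClosed_setOf_rank_le {m n : Type*} [Fintype m] [Fintype n] (r : ℕ) :
    IsClosed {A : Matrix m n ℝ | A.rank ≤ r} := by
  classical
  let Φ : Matrix m n ℝ →ₗ[ℝ] ((n → ℝ) →L[ℝ] (m → ℝ)) :=
    LinearMap.toContinuousLinearMap.toLinearMap ∘ₗ toLin'.toLinearMap
  have hΦ : Continuous Φ := Φ.continuous_of_finiteDimensional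
  rw [← isOpen_compl_iff]
  convert (isOpen_setOfPred_nat_le_rank (𝕜 := ℝ) (E := n → ℝ) (F := m → ℝ) (r + 1)).preimage hΦ
    using 1
  ext A
  have hrank : ((Φ A : (n → ℝ) →L[ℝ] (m → ℝ)) : (n → ℝ) →ₗ[ℝ] (m → ℝ)).rank = (A.rank : ℕ) := by
    rw [rank, Module.finrank_eq_rank]
    rfl
  simp only [Set.mem_compl_iff, Set.mem_ofPred_eq, Set.mem_preimage, hrank, Nat.cast_le, not_le]
  rfl

/-- Two orthonormal systems of columns that are mutually orthogonal and complementary in number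
resolve the identity. -/
theorem mul_transpose_add_mul_transpose_eq_one {m k : ℕ} (hk : k ≤ m)
    {U : Matrix (Fin m) (Fin k) ℝ} {W : Matrix (Fin m) (Fin (m - k)) ℝ}
    (hU : Uᵀ * U = 1) (hW : Wᵀ * W = 1) (hUW : Uᵀ * W = 0) :
    U * Uᵀ + W * Wᵀ = 1 := by
  have hWU : Wᵀ * U = 0 := by simpa using congrArg transpose hUW
  have e : Fin m ≃ Fin k ⊕ Fin (m - k) := (finCongr (by omega)).trans finSumFinEquiv.symm
  rw [← fromCols_mul_fromRows, fromCols_mul_fromRows_eq_one_comm e, fromRows_mul_fromCols,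
    hU, hW, hUW, hWU, fromBlocks_one]

end Matrix

theorem exists_eq_mul_of_colSpace_le {m n l : ℕ} {A : Matrix (Fin m) (Fin n) ℝ}
    {B : Matrix (Fin m) (Fin l) ℝ} (h : colSpace A ≤ colSpace B) :
    ∃ T : Matrix (Fin l) (Fin n) ℝ, A = B * T := by
  have hcol (j : Fin n) : ∃ v : Fin l → ℝ, B *ᵥ v = A.col j := by
    obtain ⟨v, hv⟩ := h ⟨WithLp.toLp 2 (Pi.single j 1), rfl⟩
    exact ⟨v.ofLp, by simpa using congrArg WithLp.ofLp hv⟩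
  choose v hv using hcol
  refine ⟨Matrix.of fun i j => v j i, ?_⟩
  ext i j
  exact (congrFun (hv j) i).symm

theorem transpose_mul_eq_zero_of_colSpace_le_orthogonal {m n l : ℕ}
    {A : Matrix (Fin m) (Fin n) ℝ} {B : Matrix (Fin m) (Fin l) ℝ}
    (h : colSpace A ≤ (colSpace B)ᗮ) : Aᵀ * B = 0 := by
  ext i j
  have hA : WithLp.toLp 2 (A.col i) ∈ colSpace A :=
    ⟨WithLp.toLp 2 (Pi.single i 1), by simp [Matrix.toLpLin_apply]⟩
  have hB : WithLp.toLp 2 (B.col j) ∈ colSpace B :=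
    ⟨WithLp.toLp 2 (Pi.single j 1), by simp [Matrix.toLpLin_apply]⟩
  have hinner := (Submodule.mem_orthogonal _ _).1 (h hA) _ hB
  simpa [EuclideanSpace.inner_eq_star_dotProduct, Matrix.mul_apply, dotProduct] using hinner

/-- Multiplying by `(1 + tG)` and `(1 + tH)` does not raise the rank, so the tangent cone contains
`G * X + X * H + E` as soon as `E` has small enough rank. -/
theorem add_mem_seqTangentCone_rank_le {m n r : ℕ} {X E : Matrix (Fin m) (Fin n) ℝ}
    (hE : X.rank + E.rank ≤ r) (G : Matrix (Fin m) (Fin m) ℝ) (H : Matrix (Fin n) (Fin n) ℝ) :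
    G * X + X * H + E ∈ seqTangentCone {Y : Matrix (Fin m) (Fin n) ℝ | Y.rank ≤ r} X := by
  have ht : Tendsto (fun i : ℕ => 1 / ((i : ℝ) + 1)) atTop (𝓝 0) :=
    tendsto_one_div_add_atTop_nhds_zero_nat
  have hpos (i : ℕ) : 0 < 1 / ((i : ℝ) + 1) := Nat.one_div_pos_of_nat
  have hexpand (t : ℝ) : (1 + t • G) * X * (1 + t • H) + t • E =
      X + t • (G * X + X * H + E + t • (G * X * H)) := by
    simp only [Matrix.add_mul, Matrix.mul_add, Matrix.one_mul, Matrix.mul_one, Matrix.smul_mul,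
      Matrix.mul_smul, smul_add]
    abel
  have hrem : Tendsto (fun i : ℕ => G * X + X * H + E + (1 / ((i : ℝ) + 1)) • (G * X * H))
      atTop (𝓝 (G * X + X * H + E)) := by
    simpa using (ht.smul_const (G * X * H)).const_add (G * X + X * H + E)
  refine ⟨fun i => (1 + (1 / ((i : ℝ) + 1)) • G) * X * (1 + (1 / ((i : ℝ) + 1)) • H) +
    (1 / ((i : ℝ) + 1)) • E, fun i => 1 / ((i : ℝ) + 1), fun i => ?_, hpos, ?_, ?_⟩
  · refine (Matrix.rank_add_le_add _ _).trans (le_trans (add_le_add ?_ ?_) hE)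
    · exact (Matrix.rank_mul_le_left _ _).trans (Matrix.rank_mul_le_right _ _)
    · exact (Matrix.rank_smul_of_mem_nonZeroDivisors E
        (mem_nonZeroDivisors_of_ne_zero (hpos i).ne')).le
  · simp only [hexpand]
    simpa using (ht.smul hrem).const_add X
  · refine hrem.congr fun i => ?_
    beta_reduce
    rw [hexpand, add_sub_cancel_left, inv_smul_smul₀ (hpos i).ne']

/-- Rescaling the part of a curve that lies in the orthogonal complement of the column space of `X`
keeps its rank bounded and has a limit. -/
theorem rank_add_mul_le_of_mem_seqTangentCone {m n r : ℕ} {X Z : Matrix (Fin m) (Fin n) ℝ}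
    {P Q : Matrix (Fin m) (Fin m) ℝ} (hPX : P * X = X) (hQX : Q * X = 0)
    (hZ : Z ∈ seqTangentCone {Y : Matrix (Fin m) (Fin n) ℝ | Y.rank ≤ r} X) :
    (X + Q * Z).rank ≤ r := by
  obtain ⟨Y, t, hY, -, hYX, hYZ⟩ := hZ
  have hlim : Tendsto (fun i => (P + (t i)⁻¹ • Q) * Y i) atTop (𝓝 (X + Q * Z)) := by
    have hP : Tendsto (fun i => P * Y i) atTop (𝓝 (P * X)) :=
      ((continuous_const.matrix_mul continuous_id).tendsto X).comp hYX
    have hQ : Tendsto (fun i => Q * ((t i)⁻¹ • (Y i - X))) atTop (𝓝 (Q * Z)) :=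
      ((continuous_const.matrix_mul continuous_id).tendsto Z).comp hYZ
    rw [hPX] at hP
    refine (hP.add hQ).congr fun i => ?_
    rw [Matrix.mul_smul, Matrix.mul_sub, hQX, sub_zero, Matrix.add_mul, Matrix.smul_mul]
  exact (Matrix.isClosed_setOf_rank_le r).mem_of_tendsto hlim
    (Eventually.of_forall fun i => (Matrix.rank_mul_le_right _ _).trans (hY i))

/-- block-parametrized description of the tangent cone to
`ℝ_{≤r}^{m×n}` at `X`, with `r̲ = rank X`. -/
theorem tangentCone_rank_le_block_description
    {m n r : ℕ} (hr : r < min m n)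
    (X : Matrix (Fin m) (Fin n) ℝ) (hX : X.rank ≤ r)
    (U : Matrix (Fin m) (Fin X.rank) ℝ)
    (Uperp : Matrix (Fin m) (Fin (m - X.rank)) ℝ)
    (V : Matrix (Fin n) (Fin X.rank) ℝ)
    (Vperp : Matrix (Fin n) (Fin (n - X.rank)) ℝ)
    (hUo : Uᵀ * U = 1) (hUpo : Uperpᵀ * Uperp = 1)
    (hVo : Vᵀ * V = 1) (hVpo : Vperpᵀ * Vperp = 1)
    (hUc : colSpace U = colSpace X)
    (hUpc : colSpace Uperp = (colSpace X)ᗮ)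
    (hVc : colSpace V = colSpace Xᵀ)
    (hVpc : colSpace Vperp = (colSpace Xᵀ)ᗮ) :
    seqTangentCone {Y : Matrix (Fin m) (Fin n) ℝ | Y.rank ≤ r} X
      = {Z : Matrix (Fin m) (Fin n) ℝ |
          ∃ (A : Matrix (Fin X.rank) (Fin X.rank) ℝ)
            (B : Matrix (Fin X.rank) (Fin (n - X.rank)) ℝ)
            (C : Matrix (Fin (m - X.rank)) (Fin X.rank) ℝ)
            (D : Matrix (Fin (m - X.rank)) (Fin (n - X.rank)) ℝ),
            D.rank ≤ r - X.rank ∧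
            Z = U * A * Vᵀ + U * B * Vperpᵀ + Uperp * C * Vᵀ + Uperp * D * Vperpᵀ} := by
  have hUpX : Uperpᵀ * X = 0 := transpose_mul_eq_zero_of_colSpace_le_orthogonal hUpc.le
  have hXVp : X * Vperp = 0 := by
    simpa using congrArg transpose (transpose_mul_eq_zero_of_colSpace_le_orthogonal hVpc.le)
  have hUpU : Uperpᵀ * U = 0 :=
    transpose_mul_eq_zero_of_colSpace_le_orthogonal (hUpc.trans (by rw [hUc])).le
  have hVpV : Vperpᵀ * V = 0 :=
    transpose_mul_eq_zero_of_colSpace_le_orthogonal (hVpc.trans (by rw [hVc])).le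
  have hU1 : U * Uᵀ + Uperp * Uperpᵀ = 1 :=
    mul_transpose_add_mul_transpose_eq_one X.rank_le_height hUo hUpo
      (by simpa using congrArg transpose hUpU)
  have hV1 : V * Vᵀ + Vperp * Vperpᵀ = 1 :=
    mul_transpose_add_mul_transpose_eq_one X.rank_le_width hVo hVpo
      (by simpa using congrArg transpose hVpV)
  have hUX : U * Uᵀ * X = X := by
    have := congrArg (· * X) hU1
    simpa [Matrix.add_mul, Matrix.mul_assoc, hUpX] using this
  ext Z
  constructor
  · intro hZ
    refine ⟨Uᵀ * Z * V, Uᵀ * Z * Vperp, Uperpᵀ * Z * V, Uperpᵀ * Z * Vperp, ?_, ?_⟩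
    · have hW := rank_add_mul_le_of_mem_seqTangentCone hUX
        (by rw [Matrix.mul_assoc, hUpX, Matrix.mul_zero] : Uperp * Uperpᵀ * X = 0) hZ
      have hUUp : Uᵀ * Uperp = 0 := by simpa using congrArg transpose hUpU
      have hleft : Uᵀ * (X + Uperp * Uperpᵀ * Z) = Uᵀ * X := by
        rw [Matrix.mul_add, Matrix.mul_assoc Uperp, ← Matrix.mul_assoc Uᵀ Uperp, hUUp,
          Matrix.zero_mul, add_zero]
      have hright : (X + Uperp * Uperpᵀ * Z) * Vperp = Uperp * (Uperpᵀ * Z * Vperp) := by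
        simp only [Matrix.add_mul, hXVp, zero_add, Matrix.mul_assoc]
      have hfrob := rank_mul_add_rank_mul_le_of_mul_mul_eq_zero Uᵀ
        (X + Uperp * Uperpᵀ * Z) Vperp
        (by rw [hleft, Matrix.mul_assoc, hXVp, Matrix.mul_zero])
      rw [hleft, hright] at hfrob
      have hXle : X.rank ≤ (Uᵀ * X).rank := by
        have := rank_mul_le_right U (Uᵀ * X)
        rwa [← Matrix.mul_assoc, hUX] at this
      have hDle : (Uperpᵀ * Z * Vperp).rank ≤ (Uperp * (Uperpᵀ * Z * Vperp)).rank := by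
        have := rank_mul_le_right Uperpᵀ (Uperp * (Uperpᵀ * Z * Vperp))
        rwa [← Matrix.mul_assoc, hUpo, Matrix.one_mul] at this
      omega
    · calc Z = (U * Uᵀ + Uperp * Uperpᵀ) * Z * (V * Vᵀ + Vperp * Vperpᵀ) := by
            rw [hU1, hV1, Matrix.one_mul, Matrix.mul_one]
        _ = _ := by
            simp only [Matrix.add_mul, Matrix.mul_add, Matrix.mul_assoc]
            abel
  · rintro ⟨A, B, C, D, hD, rfl⟩
    obtain ⟨T, hT⟩ := exists_eq_mul_of_colSpace_le hUc.le
    obtain ⟨R, hR⟩ := exists_eq_mul_of_colSpace_le hVc.le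
    have hR' : Rᵀ * X = Vᵀ := by simpa [transpose_mul] using (congrArg transpose hR).symm
    have hE : X.rank + (Uperp * D * Vperpᵀ).rank ≤ r := by
      have := (rank_mul_le_left (Uperp * D) Vperpᵀ).trans (rank_mul_le_right Uperp D)
      omega
    convert add_mem_seqTangentCone_rank_le hE (Uperp * C * Rᵀ) (T * (A * Vᵀ + B * Vperpᵀ)) using 1
    rw [Matrix.mul_assoc (Uperp * C), hR', ← Matrix.mul_assoc X, ← hT, Matrix.mul_add,
      ← Matrix.mul_assoc U, ← Matrix.mul_assoc U]
    abel
end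

section
/- Let m, n, r ∈ ℕ with r < min(m, n), let X ∈ ℝ^{m×n} with rank X ≤ r, and set r̲ = rank X. Let U_⊥ ∈ ℝ^{m×(m−r̲)} and V_⊥ ∈ ℝ^{n×(n−r̲)} have orthonormal columns with column spaces equal to the orthogonal complements of the column spaces of X and Xᵀ respectively. Suppose there exist a sequence (X_i) of matrices with rank X_i ≤ r converging to X and a sequence (t_i) of positive real numbers such that (X_i − X)/t_i converges to Z ∈ ℝ^{m×n}. Then rank(U_⊥ᵀ Z V_⊥) ≤ r − r̲. -/
open Matrix

/-- If the column spaces of `A` and `B` are orthogonal, then `Bᵀ * A = 0`. -/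
theorem transpose_mul_eq_zero_of_colSpace_le {m n p : ℕ}
    {A : Matrix (Fin m) (Fin n) ℝ} {B : Matrix (Fin m) (Fin p) ℝ}
    (h : colSpace A ≤ (colSpace B)ᗮ) : Bᵀ * A = 0 := by
  ext i j
  have hA : Matrix.toEuclideanLin A (EuclideanSpace.single j 1) ∈ (colSpace B)ᗮ :=
    h (LinearMap.mem_range_self _ _)
  have hB : Matrix.toEuclideanLin B (EuclideanSpace.single i 1) ∈ colSpace B :=
    LinearMap.mem_range_self _ _
  have := Submodule.inner_right_of_mem_orthogonal hB hA
  simpa [PiLp.inner_apply, Matrix.mul_apply, Matrix.toLpLin_apply, mul_comm] using this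

/-- A real matrix of rank at least `k` can be compressed to a `k × k` matrix with nonzero
determinant. -/
theorem Matrix.exists_det_mul_mul_ne_zero {m n : Type*} [Fintype m] [Fintype n]
    (M : Matrix m n ℝ) {k : ℕ} (hk : k ≤ M.rank) :
    ∃ (C : Matrix (Fin k) m ℝ) (D : Matrix n (Fin k) ℝ), (C * M * D).det ≠ 0 := by
  obtain ⟨f, hf⟩ := exists_linearIndependent_of_le_finrank (R := ℝ)
    (M := LinearMap.range M.mulVecLin) hk
  choose d hd using fun j => (f j).2
  have hcol : (M * (Matrix.of d)ᵀ)ᵀ = Matrix.of fun j => (f j : m → ℝ) := by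
    ext j i
    rw [Matrix.of_apply, ← hd j]
    rfl
  have hrank : (M * (Matrix.of d)ᵀ).rank = k := by
    rw [← Matrix.rank_transpose, hcol]
    have hli := hf.map' _ (Submodule.ker_subtype _)
    simpa using LinearIndependent.rank_matrix (M := Matrix.of fun j => (f j : m → ℝ)) hli
  refine ⟨(M * (Matrix.of d)ᵀ)ᵀ, (Matrix.of d)ᵀ, fun h => ?_⟩
  rw [Matrix.mul_assoc] at h
  obtain ⟨v, hv, hv0⟩ := Matrix.exists_mulVec_eq_zero_iff.mpr h
  have hr := Matrix.rank_transpose_mul_self (M * (Matrix.of d)ᵀ)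
  rw [hrank] at hr
  have hsum := LinearMap.finrank_range_add_finrank_ker
    ((M * (Matrix.of d)ᵀ)ᵀ * (M * (Matrix.of d)ᵀ)).mulVecLin
  rw [Matrix.rank] at hr
  rw [hr, Module.finrank_fin_fun, Nat.add_eq_left, Submodule.finrank_eq_zero] at hsum
  exact hv ((Submodule.mem_bot ℝ).mp (hsum ▸ LinearMap.mem_ker.mpr hv0))

/-- if `Z` is the limit of `(X_i - X)/t_i` with `rank X_i ≤ r`,
`X_i → X`, `t_i > 0`, then `rank (U_⊥ᵀ Z V_⊥) ≤ r - rank X`. -/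
theorem rank_proj_le_of_tangent
    {m n r : ℕ} (hr : r < min m n)
    (X : Matrix (Fin m) (Fin n) ℝ) (hX : X.rank ≤ r)
    (Uperp : Matrix (Fin m) (Fin (m - X.rank)) ℝ)
    (Vperp : Matrix (Fin n) (Fin (n - X.rank)) ℝ)
    (hUo : Uperpᵀ * Uperp = 1) (hVo : Vperpᵀ * Vperp = 1)
    (hUc : colSpace Uperp = (colSpace X)ᗮ)
    (hVc : colSpace Vperp = (colSpace Xᵀ)ᗮ)
    (Z : Matrix (Fin m) (Fin n) ℝ)
    (Xs : ℕ → Matrix (Fin m) (Fin n) ℝ) (t : ℕ → ℝ)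
    (hXs : ∀ i, (Xs i).rank ≤ r) (ht : ∀ i, 0 < t i)
    (hconv : Filter.Tendsto Xs Filter.atTop (nhds X))
    (hquot : Filter.Tendsto (fun i => (t i)⁻¹ • (Xs i - X)) Filter.atTop (nhds Z)) :
    (Uperpᵀ * Z * Vperp).rank ≤ r - X.rank := by
  have hXV : X * Vperp = 0 := by
    simpa using transpose_mul_eq_zero_of_colSpace_le hVc.le
  have hUX : Uperpᵀ * X = 0 := by
    have := congrArg Matrix.transpose (transpose_mul_eq_zero_of_colSpace_le hUc.le)
    simpa using this
  by_contra! hlt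
  obtain ⟨A, B, hAB⟩ := X.exists_det_mul_mul_ne_zero le_rfl
  obtain ⟨C, D, hCD⟩ := (Uperpᵀ * Z * Vperp).exists_det_mul_mul_ne_zero (Nat.succ_le_of_lt hlt)
  let Q : ℕ → Matrix (Fin m) (Fin n) ℝ := fun i => (t i)⁻¹ • (Xs i - X)
  have hQ : ∀ i, Xs i * ((t i)⁻¹ • (Vperp * D)) = Q i * (Vperp * D) := fun i => by
    simp only [Q]
    rw [Matrix.mul_smul, Matrix.smul_mul, Matrix.sub_mul, ← Matrix.mul_assoc X, hXV,
      Matrix.zero_mul, sub_zero]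
  let F : Matrix (Fin m) (Fin n) ℝ × Matrix (Fin m) (Fin n) ℝ → ℝ := fun p =>
    (Matrix.fromRows A (C * Uperpᵀ) *
      Matrix.fromCols (p.1 * B) (p.2 * (Vperp * D))).det
  have hF : Continuous F := by
    simp only [F, Matrix.fromRows_mul_fromCols]
    fun_prop
  have hF0 : F (X, Z) ≠ 0 := by
    have h21 : C * Uperpᵀ * (X * B) = 0 := by
      rw [Matrix.mul_assoc, ← Matrix.mul_assoc Uperpᵀ, hUX, Matrix.zero_mul, Matrix.mul_zero]
    simp only [F, Matrix.fromRows_mul_fromCols, h21, Matrix.det_fromBlocks_zero₂₁]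
    exact mul_ne_zero (by simpa only [Matrix.mul_assoc] using hAB)
      (by simpa only [Matrix.mul_assoc] using hCD)
  obtain ⟨i, hi⟩ := (((hF.tendsto (X, Z)).comp (hconv.prodMk_nhds hquot)).eventually_ne hF0).exists
  have hrank := Matrix.rank_of_det_ne_zero hi
  have hle : (Matrix.fromRows A (C * Uperpᵀ) *
      Matrix.fromCols (Xs i * B) (Q i * (Vperp * D))).rank ≤ r := by
    rw [← hQ, ← Matrix.mul_fromCols]
    exact ((Matrix.rank_mul_le_right _ _).trans (Matrix.rank_mul_le_left _ _)).trans (hXs i)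
  have hge := hrank.symm.trans_le hle
  simp only [Fintype.card_sum, Fintype.card_fin] at hge
  omega
end

section
/- Let m, n, r ∈ ℕ with r < min(m, n), let X ∈ ℝ^{m×n} with r̲ = rank X ≤ r. Suppose Z₁ ∈ ℝ^{m×n} is tangent to ℝ_{=r̲}^{m×n} at X, i.e., there exist a sequence (Y_i) of matrices of rank exactly r̲ converging to X and a sequence (t_i) of positive real numbers such that (Y_i − X)/t_i converges to Z₁, and let Z₂ ∈ ℝ^{m×n} satisfy rank Z₂ ≤ r − r̲. Then Z₁ + Z₂ belongs to the tangent cone to ℝ_{≤r}^{m×n} at X. -/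
open Matrix

/-- The rank of matrices over a field is subadditive. -/
theorem Matrix.rank_add_le_rank_add_rank {ι κ K : Type*} [Fintype κ] [Finite ι] [Field K]
    (A B : Matrix ι κ K) : (A + B).rank ≤ A.rank + B.rank := by
  have hrange : LinearMap.range (A + B).mulVecLin ≤
      LinearMap.range A.mulVecLin ⊔ LinearMap.range B.mulVecLin := by
    rw [Matrix.mulVecLin_add]
    exact LinearMap.range_add_le A.mulVecLin B.mulVecLin
  exact (Submodule.finrank_mono hrange).trans
    (Submodule.finrank_add_le_finrank_add_finrank _ _)

open Filter Topology in
/-- The scaling sequence of a nonzero tangent vector tends to zero. -/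
theorem tendsto_zero_of_tendsto_inv_smul_sub {ι κ : Type*} {X Z : Matrix ι κ ℝ}
    {Y : ℕ → Matrix ι κ ℝ} {t : ℕ → ℝ} (ht : ∀ i, 0 < t i) (hconv : Tendsto Y atTop (𝓝 X))
    (hquot : Tendsto (fun i => (t i)⁻¹ • (Y i - X)) atTop (𝓝 Z)) (hZ : Z ≠ 0) :
    Tendsto t atTop (𝓝 0) := by
  obtain ⟨a, b, hab⟩ : ∃ a b, Z a b ≠ 0 := by
    by_contra! h
    exact hZ (Matrix.ext h)
  have entry : Continuous fun M : Matrix ι κ ℝ => M a b := continuous_id.matrix_elem a b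
  have hq : Tendsto (fun i => (t i)⁻¹ * (Y i a b - X a b)) atTop (𝓝 (Z a b)) :=
    (entry.tendsto Z).comp hquot
  have hd : Tendsto (fun i => Y i a b - X a b) atTop (𝓝 0) := by
    simpa using ((entry.tendsto X).comp hconv).sub_const (X a b)
  have h := hd.div hq hab
  rw [zero_div] at h
  refine h.congr' ?_
  filter_upwards [hq.eventually_ne hab] with i hi
  have := right_ne_zero_of_mul hi
  have := (ht i).ne'
  simp only [Pi.div_apply]
  field_simp

open Filter Topology in
/-- Adding a low-rank direction to a tangent sequence of constant rank whose scaling tends to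
zero gives a tangent vector to the matrices of bounded rank. -/
theorem add_mem_seqTangentCone_of_tendsto_zero {m n r : ℕ} {X Z₁ Z₂ : Matrix (Fin m) (Fin n) ℝ}
    (hX : X.rank ≤ r) {Y : ℕ → Matrix (Fin m) (Fin n) ℝ} {t : ℕ → ℝ}
    (hY : ∀ i, (Y i).rank = X.rank) (ht : ∀ i, 0 < t i) (ht₀ : Tendsto t atTop (𝓝 0))
    (hconv : Tendsto Y atTop (𝓝 X))
    (hquot : Tendsto (fun i => (t i)⁻¹ • (Y i - X)) atTop (𝓝 Z₁))
    (hZ₂ : Z₂.rank ≤ r - X.rank) :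
    Z₁ + Z₂ ∈ seqTangentCone {M : Matrix (Fin m) (Fin n) ℝ | M.rank ≤ r} X := by
  refine ⟨fun i => Y i + t i • Z₂, t, fun i => ?_, ht, ?_, ?_⟩
  · have hadd := Matrix.rank_add_le_rank_add_rank (Y i) (t i • Z₂)
    have hsmul : (t i • Z₂).rank = Z₂.rank :=
      Matrix.rank_smul_of_mem_nonZeroDivisors Z₂ (mem_nonZeroDivisors_of_ne_zero (ht i).ne')
    have := hY i
    change (Y i + t i • Z₂).rank ≤ r
    omega
  · simpa using hconv.add (ht₀.smul_const Z₂)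
  · refine (hquot.add_const Z₂).congr fun i => ?_
    rw [add_sub_right_comm, smul_add, inv_smul_smul₀ (ht i).ne']

/-- if `Z₁` is tangent to the fixed-rank stratum `ℝ_{=r̲}^{m×n}` at `X`
(with `r̲ = rank X ≤ r`) and `rank Z₂ ≤ r - r̲`, then `Z₁ + Z₂` belongs to the
tangent cone to `ℝ_{≤r}^{m×n}` at `X`. -/
theorem add_mem_tangentCone_rank_le
    {m n r : ℕ} (hr : r < min m n)
    (X : Matrix (Fin m) (Fin n) ℝ) (hX : X.rank ≤ r)
    (Z₁ Z₂ : Matrix (Fin m) (Fin n) ℝ)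
    (Y : ℕ → Matrix (Fin m) (Fin n) ℝ) (t : ℕ → ℝ)
    (hY : ∀ i, (Y i).rank = X.rank) (ht : ∀ i, 0 < t i)
    (hconv : Filter.Tendsto Y Filter.atTop (nhds X))
    (hquot : Filter.Tendsto (fun i => (t i)⁻¹ • (Y i - X)) Filter.atTop (nhds Z₁))
    (hZ₂ : Z₂.rank ≤ r - X.rank) :
    Z₁ + Z₂ ∈ seqTangentCone {M : Matrix (Fin m) (Fin n) ℝ | M.rank ≤ r} X := by
  by_cases hZ : Z₁ = 0
  · subst hZ
    exact add_mem_seqTangentCone_of_tendsto_zero (Y := fun _ => X) hX (fun _ => rfl)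
      (fun _ => Nat.one_div_pos_of_nat) tendsto_one_div_add_atTop_nhds_zero_nat
      tendsto_const_nhds (by simp) hZ₂
  · exact add_mem_seqTangentCone_of_tendsto_zero hX hY ht
      (tendsto_zero_of_tendsto_inv_smul_sub ht hconv hquot hZ) hconv hquot hZ₂
end

section
/- Let m, n, r̲, k ∈ ℕ with r̲ ≤ min(m, n). Let U_⊥ ∈ ℝ^{m×(m−r̲)} and V_⊥ ∈ ℝ^{n×(n−r̲)} have orthonormal columns. Then the Minkowski sum { Z ∈ ℝ^{m×n} : U_⊥ᵀ Z V_⊥ = 0 } + { W ∈ ℝ^{m×n} : rank W ≤ k } equals { Z ∈ ℝ^{m×n} : rank(U_⊥ᵀ Z V_⊥) ≤ k }. -/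
open Matrix Pointwise

/-- Multiplying a matrix on both sides does not increase its rank. -/
theorem Matrix.rank_mul_mul_le {R l m n o : Type*} [CommSemiring R] [StrongRankCondition R]
    [Fintype m] [Fintype n] [Fintype o]
    (A : Matrix l m R) (B : Matrix m n R) (C : Matrix n o R) :
    (A * B * C).rank ≤ B.rank :=
  (rank_mul_le_left _ _).trans (rank_mul_le_right _ _)

/-- If `A` and `B` have orthonormal columns, then `X ↦ Aᵀ * X * B` is a left inverse of
`Y ↦ A * Y * Bᵀ`. -/
theorem Matrix.transpose_mul_conj_mul_of_orthonormal {R m n p q : Type*} [CommSemiring R]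
    [Fintype m] [Fintype n] [Fintype p] [Fintype q] [DecidableEq p] [DecidableEq q]
    {A : Matrix m p R} {B : Matrix n q R} (hA : Aᵀ * A = 1) (hB : Bᵀ * B = 1)
    (Y : Matrix p q R) : Aᵀ * (A * Y * Bᵀ) * B = Y := by
  calc Aᵀ * (A * Y * Bᵀ) * B = (Aᵀ * A) * Y * (Bᵀ * B) := by simp only [Matrix.mul_assoc]
    _ = Y := by rw [hA, hB, Matrix.one_mul, Matrix.mul_one]

/-- the Minkowski sum of the space `{Z : U_⊥ᵀ Z V_⊥ = 0}` and the set of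
matrices of rank at most `k` equals `{Z : rank (U_⊥ᵀ Z V_⊥) ≤ k}`. -/
theorem minkowski_sum_tangent_space_low_rank
    {m n r' k : ℕ} (hr' : r' ≤ min m n)
    (Uperp : Matrix (Fin m) (Fin (m - r')) ℝ)
    (Vperp : Matrix (Fin n) (Fin (n - r')) ℝ)
    (hUo : Uperpᵀ * Uperp = 1) (hVo : Vperpᵀ * Vperp = 1) :
    {Z : Matrix (Fin m) (Fin n) ℝ | Uperpᵀ * Z * Vperp = 0}
      + {W : Matrix (Fin m) (Fin n) ℝ | W.rank ≤ k}
      = {Z : Matrix (Fin m) (Fin n) ℝ | (Uperpᵀ * Z * Vperp).rank ≤ k} := by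
  ext Z
  simp only [Set.mem_add, Set.mem_ofPred_eq]
  constructor
  · rintro ⟨X, hX, W, hW, rfl⟩
    rw [Matrix.mul_add, Matrix.add_mul, hX, zero_add]
    exact (rank_mul_mul_le _ _ _).trans hW
  · intro hZ
    refine ⟨Z - Uperp * (Uperpᵀ * Z * Vperp) * Vperpᵀ, ?_,
      Uperp * (Uperpᵀ * Z * Vperp) * Vperpᵀ, (rank_mul_mul_le _ _ _).trans hZ,
      sub_add_cancel _ _⟩
    rw [Matrix.mul_sub, Matrix.sub_mul, transpose_mul_conj_mul_of_orthonormal hUo hVo, sub_self]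
end

section
/- Let 𝒰₁ and 𝒰₂ be linear subspaces of ℝ^m with 𝒰₁ ∩ 𝒰₂ = {0}, and 𝒱₁ and 𝒱₂ linear subspaces of ℝ^n with 𝒱₁ ∩ 𝒱₂ = {0}. Let A₁, A₂ ∈ ℝ^{m×n} be such that, for each i ∈ {1, 2}, the column space of A_i is contained in 𝒰_i and the column space of A_iᵀ is contained in 𝒱_i. Then rank(A₁ + A₂) = rank A₁ + rank A₂. -/
open Matrix

/-- If the row spaces of `A` and `B` are disjoint, then the column space of `A` is contained in
that of `A + B`. -/
theorem range_mulVecLin_le_range_add_of_disjoint {K m n : Type*} [Field K] [Fintype m] [Fintype n]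
    {A B : Matrix m n K}
    (h : Disjoint (LinearMap.range Aᵀ.mulVecLin) (LinearMap.range Bᵀ.mulVecLin)) :
    LinearMap.range A.mulVecLin ≤ LinearMap.range (A + B).mulVecLin := by
  classical
  obtain ⟨W, hW, hWB⟩ := h.exists_isCompl
  let P : Matrix n n K := LinearMap.toMatrix' (Submodule.projection _ _ hWB)
  have hPA : P * Aᵀ = Aᵀ := by
    refine Matrix.ext_of_mulVec_single fun i => ?_
    rw [← mulVec_mulVec, LinearMap.toMatrix'_mulVec]
    exact Submodule.projection_apply_of_mem_left hWB (hW ⟨_, rfl⟩)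
  have hPB : P * Bᵀ = 0 := by
    refine Matrix.ext_of_mulVec_single fun i => ?_
    rw [← mulVec_mulVec, LinearMap.toMatrix'_mulVec, zero_mulVec]
    exact (Submodule.projection_apply_eq_zero_iff hWB).2 ⟨_, rfl⟩
  have hA : (A + B) * Pᵀ = A := by
    rw [← transpose_inj, transpose_mul, transpose_transpose, transpose_add, Matrix.mul_add,
      hPA, hPB, add_zero]
  nth_rewrite 1 [← hA]
  rw [mulVecLin_mul]
  exact LinearMap.range_comp_le_range _ _

/-- if the column spaces of `A₁`, `A₂` lie in complementary-intersection
subspaces `𝒰₁`, `𝒰₂` and the column spaces of `A₁ᵀ`, `A₂ᵀ` lie in `𝒱₁`, `𝒱₂` with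
`𝒰₁ ∩ 𝒰₂ = {0}` and `𝒱₁ ∩ 𝒱₂ = {0}`, then `rank (A₁ + A₂) = rank A₁ + rank A₂`. -/
theorem rank_add_of_independent_spaces
    {m n : ℕ} (U₁ U₂ : Submodule ℝ (Fin m → ℝ)) (hU : U₁ ⊓ U₂ = ⊥)
    (V₁ V₂ : Submodule ℝ (Fin n → ℝ)) (hV : V₁ ⊓ V₂ = ⊥)
    (A₁ A₂ : Matrix (Fin m) (Fin n) ℝ)
    (hA₁U : LinearMap.range A₁.mulVecLin ≤ U₁)
    (hA₁V : LinearMap.range A₁ᵀ.mulVecLin ≤ V₁)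
    (hA₂U : LinearMap.range A₂.mulVecLin ≤ U₂)
    (hA₂V : LinearMap.range A₂ᵀ.mulVecLin ≤ V₂) :
    (A₁ + A₂).rank = A₁.rank + A₂.rank := by
  have hV' : Disjoint (LinearMap.range A₁ᵀ.mulVecLin) (LinearMap.range A₂ᵀ.mulVecLin) :=
    (disjoint_iff.2 hV).mono hA₁V hA₂V
  have hU' : LinearMap.range A₁.mulVecLin ⊓ LinearMap.range A₂.mulVecLin = ⊥ :=
    ((disjoint_iff.2 hU).mono hA₁U hA₂U).eq_bot
  have hrange : LinearMap.range (A₁ + A₂).mulVecLin =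
      LinearMap.range A₁.mulVecLin ⊔ LinearMap.range A₂.mulVecLin := by
    refine le_antisymm ?_ (sup_le (range_mulVecLin_le_range_add_of_disjoint hV') ?_)
    · rw [mulVecLin_add]
      exact LinearMap.range_add_le _ _
    · rw [add_comm]
      exact range_mulVecLin_le_range_add_of_disjoint hV'.symm
  rw [Matrix.rank, Matrix.rank, Matrix.rank, hrange, ← Submodule.finrank_sup_add_finrank_inf_eq,
    hU', finrank_bot, add_zero]
end

section
/- Let X ∈ ℝ^{4×4} be the diagonal matrix diag(1, 1, 0, 0) and, for each integer i ≥ 1, let X_i ∈ ℝ^{4×4} be the matrix with rows (1, 0, 0, 0), (0, 1, 0, 1/i), (0, 0, 1/i, 0), (0, 1/i, 0, 1/i²). Let Z ∈ ℝ^{4×4} be the matrix with rows (0, 0, 0, 0), (0, 0, 0, 1), (0, 0, 1, 0), (0, 1, 0, 0). Then: (a) rank X_i ≤ 3 for all i ≥ 1; (b) X_i converges to X as i → ∞; (c) i·(X_i − X) converges to Z as i → ∞ (hence Z belongs to the tangent cone to ℝ_{≤3}^{4×4} at X); and (d) for every i ≥ 1, the 2×2 submatrix of X_i formed by its last two rows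 and last two columns, namely diag(1/i, 1/i²), has rank 2. -/
open Matrix

/-- The limit matrix `X = diag(1,1,0,0)`. -/
noncomputable def Xlim : Matrix (Fin 4) (Fin 4) ℝ :=
  !![1, 0, 0, 0;
     0, 1, 0, 0;
     0, 0, 0, 0;
     0, 0, 0, 0]

/-- The sequence `X_i`. -/
noncomputable def Xseq (i : ℕ) : Matrix (Fin 4) (Fin 4) ℝ :=
  !![1, 0, 0, 0;
     0, 1, 0, (i : ℝ)⁻¹;
     0, 0, (i : ℝ)⁻¹, 0;
     0, (i : ℝ)⁻¹, 0, ((i : ℝ) ^ 2)⁻¹]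

/-- The tangent direction `Z`. -/
noncomputable def Zdir : Matrix (Fin 4) (Fin 4) ℝ :=
  !![0, 0, 0, 0;
     0, 0, 0, 1;
     0, 0, 1, 0;
     0, 1, 0, 0]

theorem rank_Xseq_le (i : ℕ) : (Xseq i).rank ≤ 3 := by
  have h : Xseq i =
      (!![1, 0, 0; 0, 1, 0; 0, 0, 1; 0, (i : ℝ)⁻¹, 0] : Matrix (Fin 4) (Fin 3) ℝ) *
        !![1, 0, 0, 0; 0, 1, 0, (i : ℝ)⁻¹; 0, 0, (i : ℝ)⁻¹, 0] := by
    ext a b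
    fin_cases a <;> fin_cases b <;> simp [Xseq, Matrix.mul_apply, Fin.sum_univ_three, sq]
  rw [h]
  exact (Matrix.rank_mul_le_left _ _).trans (Matrix.rank_le_width _)

theorem tendsto_Xseq : Filter.Tendsto Xseq Filter.atTop (nhds Xlim) := by
  have h : Filter.Tendsto (fun i : ℕ => (i : ℝ)⁻¹) Filter.atTop (nhds 0) :=
    tendsto_inv_atTop_nhds_zero_nat
  have h2 : Filter.Tendsto (fun i : ℕ => ((i : ℝ) ^ 2)⁻¹) Filter.atTop (nhds 0) := by
    simpa using h.pow 2
  refine tendsto_pi_nhds.2 fun a => tendsto_pi_nhds.2 fun b => ?_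
  fin_cases a <;> fin_cases b <;> simp [Xseq, Xlim, h, h2, -inv_pow]

theorem tendsto_smul_Xseq_sub_Xlim :
    Filter.Tendsto (fun i : ℕ => (i : ℝ) • (Xseq i - Xlim)) Filter.atTop (nhds Zdir) := by
  have h : Filter.Tendsto (fun i : ℕ => (i : ℝ) * (i : ℝ)⁻¹) Filter.atTop (nhds 1) := by
    refine tendsto_const_nhds.congr' ?_
    filter_upwards [Filter.eventually_ge_atTop 1] with i hi
    have : (i : ℝ) ≠ 0 := by positivity
    field_simp
  have h2 : Filter.Tendsto (fun i : ℕ => (i : ℝ) * ((i : ℝ) ^ 2)⁻¹) Filter.atTop (nhds 0) := by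
    simpa [sq, mul_assoc] using h.mul (tendsto_inv_atTop_nhds_zero_nat (𝕜 := ℝ))
  refine tendsto_pi_nhds.2 fun a => tendsto_pi_nhds.2 fun b => ?_
  fin_cases a <;> fin_cases b <;> simp [Xseq, Xlim, Zdir, h, h2, -inv_pow]

theorem Xseq_submatrix (i : ℕ) :
    (Xseq i).submatrix ![(2 : Fin 4), 3] ![(2 : Fin 4), 3]
      = !![(i : ℝ)⁻¹, 0; 0, ((i : ℝ) ^ 2)⁻¹] := by
  ext a b
  fin_cases a <;> fin_cases b <;> simp [Xseq]

/-- the counterexample of section 6 of the paper: the sequence `X_i` has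
rank at most 3, converges to `X`, `i (X_i - X) → Z`, yet the bottom-right `2×2`
submatrix `diag(1/i, 1/i²)` of `X_i` has rank `2` for every `i ≥ 1`. -/
theorem counterexample_gap :
    (∀ i : ℕ, 1 ≤ i → (Xseq i).rank ≤ 3) ∧
    Filter.Tendsto Xseq Filter.atTop (nhds Xlim) ∧
    Filter.Tendsto (fun i : ℕ => (i : ℝ) • (Xseq i - Xlim)) Filter.atTop (nhds Zdir) ∧
    (∀ i : ℕ, 1 ≤ i →
      (Xseq i).submatrix ![(2 : Fin 4), 3] ![(2 : Fin 4), 3]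
        = !![(i : ℝ)⁻¹, 0; 0, ((i : ℝ) ^ 2)⁻¹] ∧
      ((Xseq i).submatrix ![(2 : Fin 4), 3] ![(2 : Fin 4), 3]).rank = 2) := by
  refine ⟨fun i _ => rank_Xseq_le i, tendsto_Xseq, tendsto_smul_Xseq_sub_Xlim,
    fun i hi => ⟨Xseq_submatrix i, ?_⟩⟩
  have hi0 : (i : ℝ) ≠ 0 := by positivity
  rw [Xseq_submatrix, Matrix.rank_of_isUnit _ ((Matrix.isUnit_iff_isUnit_det _).2 ?_)]
  · simp
  · simp [Matrix.det_fin_two_of, hi0]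
end

section
/- Let m, n, r ∈ ℕ with r < min(m, n), let X ∈ ℝ^{m×n} with r̲ = rank X ≤ r, and let Z ∈ ℝ^{m×n}. Let U_⊥ ∈ ℝ^{m×(m−r̲)} and V_⊥ ∈ ℝ^{n×(n−r̲)} have orthonormal columns with column spaces equal to the orthogonal complements of the column spaces of X and Xᵀ respectively. Then the following are equivalent: (i) there exists a linear subspace S of the kernel of X with dim S = n − r such that Z maps S into the column space of X; (ii) rank(U_⊥ᵀ Z V_⊥) ≤ r − r̲. -/
open Matrix

open Module in
theorem Submodule.exists_le_finrank_eq {K V : Type*} [DivisionRing K] [AddCommGroup V]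
    [Module K V] [FiniteDimensional K V] (W : Submodule K V) {d : ℕ} (hd : d ≤ finrank K W) :
    ∃ T ≤ W, finrank K T = d := by
  let b := finBasis K W
  let f : Fin d → V := fun i => b (Fin.castLE hd i)
  have hf : LinearIndependent K f :=
    (b.linearIndependent.map' W.subtype W.ker_subtype).comp _ (Fin.castLE_injective hd)
  refine ⟨span K (Set.range f), span_le.2 ?_, ?_⟩
  · rintro _ ⟨i, rfl⟩
    exact (b _).2
  · rw [finrank_span_eq_card hf, Fintype.card_fin]

theorem toEuclideanLin_mul_apply {l m n : ℕ} (A : Matrix (Fin l) (Fin m) ℝ)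
    (B : Matrix (Fin m) (Fin n) ℝ) (v : EuclideanSpace ℝ (Fin n)) :
    toEuclideanLin (A * B) v = toEuclideanLin A (toEuclideanLin B v) := by
  simp [toEuclideanLin]

theorem ker_toEuclideanLin_transpose {m n : ℕ} (A : Matrix (Fin m) (Fin n) ℝ) :
    LinearMap.ker (toEuclideanLin Aᵀ) = (colSpace A)ᗮ := by
  rw [← conjTranspose_eq_transpose_of_trivial, toEuclideanLin_conjTranspose_eq_adjoint, colSpace,
    LinearMap.orthogonal_range]

theorem toEuclideanLin_injective_of_transpose_mul_self_eq_one {m n : ℕ}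
    {A : Matrix (Fin m) (Fin n) ℝ} (hA : Aᵀ * A = 1) :
    Function.Injective (toEuclideanLin A) := by
  refine Function.LeftInverse.injective (g := toEuclideanLin Aᵀ) fun v => ?_
  rw [← toEuclideanLin_mul_apply, hA]
  simp [toEuclideanLin]

theorem rank_add_finrank_ker_toEuclideanLin {m n : ℕ} (A : Matrix (Fin m) (Fin n) ℝ) :
    A.rank + Module.finrank ℝ (LinearMap.ker (toEuclideanLin A)) = n := by
  rw [A.rank_eq_finrank_range_toLin (EuclideanSpace.basisFun _ ℝ).toBasis
      (EuclideanSpace.basisFun _ ℝ).toBasis, ← toEuclideanLin_eq_toLin_orthonormal,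
    LinearMap.finrank_range_add_finrank_ker, finrank_euclideanSpace_fin]

/-- the Grassmannian description of the tangent cone is equivalent to the
rank condition: there is an `(n-r)`-dimensional subspace `S` of `ker X` mapped by `Z`
into `im X` iff `rank (U_⊥ᵀ Z V_⊥) ≤ r - rank X`. -/
theorem grassmann_description_iff_rank_le
    {m n r : ℕ} (hr : r < min m n)
    (X : Matrix (Fin m) (Fin n) ℝ) (hX : X.rank ≤ r)
    (Z : Matrix (Fin m) (Fin n) ℝ)
    (Uperp : Matrix (Fin m) (Fin (m - X.rank)) ℝ)
    (Vperp : Matrix (Fin n) (Fin (n - X.rank)) ℝ)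
    (hUo : Uperpᵀ * Uperp = 1) (hVo : Vperpᵀ * Vperp = 1)
    (hUc : colSpace Uperp = (colSpace X)ᗮ)
    (hVc : colSpace Vperp = (colSpace Xᵀ)ᗮ) :
    (∃ S : Submodule ℝ (EuclideanSpace ℝ (Fin n)),
        S ≤ LinearMap.ker (Matrix.toEuclideanLin X) ∧
        Module.finrank ℝ S = n - r ∧
        ∀ v ∈ S, Matrix.toEuclideanLin Z v ∈ colSpace X)
      ↔ (Uperpᵀ * Z * Vperp).rank ≤ r - X.rank := by
  have hker : LinearMap.ker (toEuclideanLin X) = LinearMap.range (toEuclideanLin Vperp) := by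
    have h := ker_toEuclideanLin_transpose Xᵀ
    rw [transpose_transpose, ← hVc] at h
    exact h
  have hcol : colSpace X = LinearMap.ker (toEuclideanLin Uperpᵀ) := by
    rw [ker_toEuclideanLin_transpose, hUc, Submodule.orthogonal_orthogonal]
  have hinj : Function.Injective (toEuclideanLin Vperp) :=
    toEuclideanLin_injective_of_transpose_mul_self_eq_one hVo
  have hmem : ∀ v, toEuclideanLin Z (toEuclideanLin Vperp v) ∈ colSpace X ↔
      v ∈ LinearMap.ker (toEuclideanLin (Uperpᵀ * Z * Vperp)) := by
    intro v
    rw [hcol, LinearMap.mem_ker, LinearMap.mem_ker, toEuclideanLin_mul_apply,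
      toEuclideanLin_mul_apply]
  have hdim := rank_add_finrank_ker_toEuclideanLin (Uperpᵀ * Z * Vperp)
  have hrn : r < n := hr.trans_le (min_le_right m n)
  constructor
  · rintro ⟨S, hSX, hSdim, hSZ⟩
    have hmap : S.comap (toEuclideanLin Vperp) ≤
        LinearMap.ker (toEuclideanLin (Uperpᵀ * Z * Vperp)) :=
      fun v hv => (hmem v).1 (hSZ _ hv)
    have hle := Submodule.finrank_mono hmap
    have heq := (Submodule.equivMapOfInjective _ hinj (S.comap (toEuclideanLin Vperp))).finrank_eq
    rw [Submodule.map_comap_eq_of_le (hSX.trans_eq hker)] at heq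
    omega
  · intro hrank
    obtain ⟨T, hT, hTdim⟩ := Submodule.exists_le_finrank_eq
      (LinearMap.ker (toEuclideanLin (Uperpᵀ * Z * Vperp))) (d := n - r) (by omega)
    refine ⟨T.map (toEuclideanLin Vperp), ?_, ?_, ?_⟩
    · rw [hker]
      exact LinearMap.map_le_range
    · rw [← (Submodule.equivMapOfInjective _ hinj T).finrank_eq, hTdim]
    · rintro _ ⟨v, hv, rfl⟩
      exact (hmem v).2 (hT hv)
end

section
/- Let m, n, r ∈ ℕ with r < min(m, n), let X ∈ ℝ^{m×n} with rank X ≤ r, and set r̲ = rank X. Let P ∈ ℝ^{m×(m−r̲)} and Q ∈ ℝ^{n×(n−r̲)} be matrices of full column rank whose column spaces equal the kernel of Xᵀ and the kernel of X, respectively. Then the algebraic tangent cone to the real algebraic set ℝ_{≤r}^{m×n} at X equals { Z ∈ ℝ^{m×n} : rank(Pᵀ Z Q) ≤ r − r̲ }. -/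
open Matrix

/-- The polynomial `f` rewritten in the variables shifted by the point `X`:
`(polyShift X f)(Y) = f(X + Y)`. Its homogeneous components are the homogeneous
components of `f` at `X`. -/
noncomputable def polyShift {m n : ℕ} (X : Matrix (Fin m) (Fin n) ℝ)
    (f : MvPolynomial (Fin m × Fin n) ℝ) : MvPolynomial (Fin m × Fin n) ℝ :=
  MvPolynomial.aeval (fun p : Fin m × Fin n =>
    MvPolynomial.X p + MvPolynomial.C (X p.1 p.2)) f

/-- The algebraic tangent cone to a set `A` of real `m × n` matrices (viewed as a subset
of `ℝ^{mn}`) at a point `X`: the common zero set of the initial polynomials at `X`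
(the lowest-degree nonzero homogeneous components in the shifted variables) of all
polynomials vanishing identically on `A`. -/
def algTangentCone {m n : ℕ} (A : Set (Matrix (Fin m) (Fin n) ℝ))
    (X : Matrix (Fin m) (Fin n) ℝ) : Set (Matrix (Fin m) (Fin n) ℝ) :=
  {Z | ∀ f : MvPolynomial (Fin m × Fin n) ℝ,
    (∀ Y ∈ A, MvPolynomial.eval (fun p : Fin m × Fin n => Y p.1 p.2) f = 0) →
    ∀ k : ℕ,
      (∀ j < k, MvPolynomial.homogeneousComponent j (polyShift X f) = 0) →
      MvPolynomial.homogeneousComponent k (polyShift X f) ≠ 0 →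
      MvPolynomial.eval (fun p : Fin m × Fin n => Z p.1 p.2)
        (MvPolynomial.homogeneousComponent k (polyShift X f)) = 0}

namespace Matrix

variable {K : Type*} [Field K] {m n o p : Type*}

theorem rank_add_le_rank_add_rank_s9 [Finite m] [Fintype n] (A B : Matrix m n K) :
    (A + B).rank ≤ A.rank + B.rank := by
  have : Fintype m := Fintype.ofFinite m
  have h : LinearMap.range (A + B).mulVecLin ≤
      LinearMap.range A.mulVecLin ⊔ LinearMap.range B.mulVecLin := by
    rintro _ ⟨v, rfl⟩
    rw [mulVecLin_add]
    exact Submodule.add_mem_sup ⟨v, rfl⟩ ⟨v, rfl⟩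
  exact (Submodule.finrank_mono h).trans (Submodule.finrank_add_le_finrank_add_finrank _ _)

/-- If the column space of `M` contains that of `N`, then `N` is a right multiple of `M`. -/
theorem exists_mul_eq_of_range_mulVecLin_le [Fintype n] [Fintype o]
    (M : Matrix m n K) (N : Matrix m o K)
    (h : LinearMap.range N.mulVecLin ≤ LinearMap.range M.mulVecLin) :
    ∃ L : Matrix n o K, M * L = N := by
  classical
  have hcol (j : o) : ∃ v : n → K, M *ᵥ v = N.col j := by
    obtain ⟨v, hv⟩ := h ⟨Pi.single j 1, rfl⟩
    exact ⟨v, by simpa using hv⟩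
  choose v hv using hcol
  refine ⟨of fun i j => v j i, ?_⟩
  ext i j
  exact congrFun (hv j) i

theorem mul_eq_zero_of_range_mulVecLin_le_ker [Fintype m] [Fintype n] [Fintype o]
    {M : Matrix m n K} {N : Matrix n o K}
    (h : LinearMap.range N.mulVecLin ≤ LinearMap.ker M.mulVecLin) : M * N = 0 := by
  classical
  apply toLin'.injective
  ext1 j
  rw [toLin'_mul, map_zero]
  ext i
  have := h ⟨Pi.single j 1, rfl⟩
  exact congrFun this i

theorem range_mulVecLin_le_ker_of_mul_eq_zero [Fintype n] [Fintype o]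
    {M : Matrix m n K} {N : Matrix n o K} (h : M * N = 0) :
    LinearMap.range N.mulVecLin ≤ LinearMap.ker M.mulVecLin := by
  rintro _ ⟨v, rfl⟩
  simp [h]

/-- Every matrix over a field has a generalized inverse. -/
theorem exists_mul_mul_eq_self [Fintype m] [Fintype n] (X : Matrix m n K) :
    ∃ G : Matrix n m K, X * G * X = X := by
  classical
  obtain ⟨g, hg⟩ := X.mulVecLin.rangeRestrict.exists_rightInverse_of_surjective
    X.mulVecLin.range_rangeRestrict
  obtain ⟨G, hG⟩ := g.exists_extend
  refine ⟨LinearMap.toMatrix' G, toLin'.injective ?_⟩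
  rw [toLin'_mul, toLin'_mul, toLin'_toMatrix']
  refine LinearMap.ext fun v => ?_
  have h₁ : G (X *ᵥ v) = g (X.mulVecLin.rangeRestrict v) :=
    LinearMap.congr_fun hG (X.mulVecLin.rangeRestrict v)
  have h₂ := congrArg Subtype.val (LinearMap.congr_fun hg (X.mulVecLin.rangeRestrict v))
  simp only [LinearMap.comp_apply, toLin'_apply, h₁]
  exact h₂

theorem exists_mul_mul_eq_one_of_le_rank [Fintype m] [Fintype n] {q : ℕ} {D : Matrix m n K}
    (h : q ≤ D.rank) :
    ∃ (U : Matrix (Fin q) m K) (V : Matrix n (Fin q) K), U * D * V = 1 := by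
  classical
  obtain ⟨v, hv⟩ := exists_linearIndependent_of_le_finrank h
  have hw (i : Fin q) : ∃ w : n → K, D *ᵥ w = v i := (v i).2
  choose w hw using hw
  let V : Matrix n (Fin q) K := of fun i j => w j i
  have hV : LinearIndependent K (D * V).col := by
    have : (D * V).col = fun i => (v i : m → K) := funext fun j => hw j
    rw [this]
    exact hv.map' (Submodule.subtype _) (Submodule.ker_subtype _)
  obtain ⟨g, hg⟩ := (toLin' (D * V)).exists_leftInverse_of_injective <|
    LinearMap.ker_eq_bot.2 (mulVec_injective_iff.2 hV)
  refine ⟨LinearMap.toMatrix' g, V, toLin'.injective ?_⟩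
  rw [Matrix.mul_assoc, toLin'_mul, toLin'_toMatrix', hg, toLin'_one]

/-- If `P` and `Q` have column spaces `ker Xᵀ` and `ker X`, then, modulo the matrices
`L * X + X * R`, every `Z` is equivalent to one whose rank is at most that of `Pᵀ * Z * Q`. -/
theorem exists_eq_mul_add_mul_add_of_range_eq_ker [Fintype m] [Fintype n] [Fintype o] [Fintype p]
    {X : Matrix m n K} {P : Matrix m o K} {Q : Matrix n p K}
    (hP : LinearMap.range P.mulVecLin = LinearMap.ker Xᵀ.mulVecLin)
    (hQ : LinearMap.range Q.mulVecLin = LinearMap.ker X.mulVecLin) (Z : Matrix m n K) :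
    ∃ (L : Matrix m m K) (R : Matrix n n K) (E : Matrix m n K),
      Z = L * X + X * R + E ∧ E.rank ≤ (Pᵀ * Z * Q).rank := by
  classical
  obtain ⟨G, hG⟩ := X.exists_mul_mul_eq_self
  obtain ⟨N, hN⟩ := Q.exists_mul_eq_of_range_mulVecLin_le (1 - G * X) <| by
    rw [hQ]
    apply range_mulVecLin_le_ker_of_mul_eq_zero
    rw [Matrix.mul_sub, Matrix.mul_one, ← Matrix.mul_assoc, hG, sub_self]
  obtain ⟨M, hM⟩ := P.exists_mul_eq_of_range_mulVecLin_le (1 - X * G)ᵀ <| by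
    rw [hP]
    apply range_mulVecLin_le_ker_of_mul_eq_zero
    rw [← transpose_mul, Matrix.sub_mul, Matrix.one_mul, hG, sub_self, transpose_zero]
  replace hM : Mᵀ * Pᵀ = 1 - X * G := by rw [← transpose_mul, hM, transpose_transpose]
  refine ⟨(1 - X * G) * Z * G, G * Z, (1 - X * G) * Z * (1 - G * X), ?_, ?_⟩
  · simp only [Matrix.sub_mul, Matrix.mul_sub, Matrix.one_mul, Matrix.mul_one, Matrix.mul_assoc]
    abel
  · have : (1 - X * G) * Z * (1 - G * X) = Mᵀ * (Pᵀ * Z * Q) * N := by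
      simp only [← hM, ← hN, Matrix.mul_assoc]
    rw [this]
    exact (rank_mul_le_left _ _).trans (rank_mul_le_right _ _)

end Matrix

namespace MvPolynomial

variable {σ R : Type*} [CommSemiring R]

theorem aeval_X_mul_eq_sum (F : MvPolynomial σ R) (a : σ → Polynomial R) :
    aeval (fun p => Polynomial.X * a p) F =
      ∑ j ∈ Finset.range (F.totalDegree + 1),
        Polynomial.X ^ j * aeval a (homogeneousComponent j F) := by
  conv_lhs => rw [← sum_homogeneousComponent F, map_sum]
  refine Finset.sum_congr rfl fun j _ => ?_
  rw [aeval_def, aeval_def, eval₂_eq, eval₂_eq, Finset.mul_sum]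
  refine Finset.sum_congr rfl fun d hd => ?_
  have hdeg : ∑ i ∈ d.support, d i = j :=
    by
    simpa [Finsupp.weight_apply, Finsupp.sum] using
      homogeneousComponent_isHomogeneous j F (mem_support_iff.1 hd)
  simp only [mul_pow, Finset.prod_mul_distrib, Finset.prod_pow_eq_pow_sum, hdeg]
  ring

theorem coeff_aeval_X_mul_C (F : MvPolynomial σ R) (z : σ → R) (k : ℕ) :
    (aeval (fun p => Polynomial.X * Polynomial.C (z p)) F).coeff k =
      eval z (homogeneousComponent k F) := by
  have h (j : ℕ) : aeval (fun p => Polynomial.C (z p)) (homogeneousComponent j F) =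
      Polynomial.C (eval z (homogeneousComponent j F)) := by
    rw [eval, coe_eval₂Hom, hom_eval₂, RingHomCompTriple.comp_eq]
    rfl
  simp only [aeval_X_mul_eq_sum, h, Polynomial.finsetSum_coeff, mul_comm (Polynomial.X ^ _),
    Polynomial.coeff_C_mul_X_pow]
  rw [Finset.sum_ite_eq]
  split_ifs with hk
  · rfl
  · rw [homogeneousComponent_eq_zero _ _ (by simpa [Nat.lt_succ_iff] using hk), map_zero]

/-- The lowest-order coefficient of a polynomial along a polynomial curve through the origin. -/
theorem coeff_aeval_X_mul_of_homogeneousComponent_eq_zero {F : MvPolynomial σ R} {k : ℕ}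
    (hF : ∀ j < k, homogeneousComponent j F = 0) (a : σ → Polynomial R) :
    (aeval (fun p => Polynomial.X * a p) F).coeff k =
      eval (fun p => (a p).coeff 0) (homogeneousComponent k F) := by
  have h : (aeval a (homogeneousComponent k F)).coeff 0 =
      eval (fun p => (a p).coeff 0) (homogeneousComponent k F) := by
    rw [← Polynomial.constantCoeff_apply, aeval_def, hom_eval₂, eval, coe_eval₂Hom]
    congr 1
    ext
    simp
  rw [aeval_X_mul_eq_sum, Polynomial.finsetSum_coeff, ← h, Finset.sum_eq_single k]
  · rw [Polynomial.coeff_X_pow_mul', if_pos le_rfl, Nat.sub_self]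
  · intro j _ hj
    rcases lt_or_gt_of_ne hj with hj | hj
    · simp [hF j hj]
    · rw [Polynomial.coeff_X_pow_mul', if_neg (by omega)]
  · intro hk
    rw [homogeneousComponent_eq_zero _ _ (by simpa [Nat.lt_succ_iff] using hk)]
    simp

end MvPolynomial

section TangentCone

variable {m n : ℕ} {X : Matrix (Fin m) (Fin n) ℝ}

theorem aeval_polyShift {S : Type*} [CommRing S] [Algebra ℝ S] (X : Matrix (Fin m) (Fin n) ℝ)
    (f : MvPolynomial (Fin m × Fin n) ℝ) (a : Fin m × Fin n → S) :
    MvPolynomial.aeval a (polyShift X f) =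
      MvPolynomial.aeval (fun p => a p + algebraMap ℝ S (X p.1 p.2)) f := by
  rw [polyShift, ← AlgHom.comp_apply]
  congr 1
  ext p
  simp

theorem mem_algTangentCone_of_forall_add_mem {A : Set (Matrix (Fin m) (Fin n) ℝ)}
    {Z W : Matrix (Fin m) (Fin n) ℝ} (h : ∀ t : ℝ, X + t • (Z + t • W) ∈ A) :
    Z ∈ algTangentCone A X := by
  intro f hf k hk _
  let a : Fin m × Fin n → Polynomial ℝ := fun p =>
    Polynomial.C (Z p.1 p.2) + Polynomial.X * Polynomial.C (W p.1 p.2)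
  have hzero : MvPolynomial.aeval (fun p => Polynomial.X * a p) (polyShift X f) = 0 := by
    refine Polynomial.funext fun t => ?_
    rw [aeval_polyShift, ← Polynomial.coe_evalRingHom, MvPolynomial.aeval_def,
      MvPolynomial.hom_eval₂, map_zero, ← hf _ (h t), MvPolynomial.eval, MvPolynomial.coe_eval₂Hom]
    congr 1
    · ext
      simp
    · ext p
      simp [a]
      ring
  have := MvPolynomial.coeff_aeval_X_mul_of_homogeneousComponent_eq_zero hk a
  rw [hzero] at this
  simpa [a] using this.symm

/-- The determinant of `U * Y * V`, as a polynomial in the entries of `Y`. -/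
noncomputable def compressionDet {ι : Type*} [Fintype ι] [DecidableEq ι]
    (U : Matrix ι (Fin m) ℝ) (V : Matrix (Fin n) ι ℝ) : MvPolynomial (Fin m × Fin n) ℝ :=
  (U.map (algebraMap ℝ (MvPolynomial (Fin m × Fin n) ℝ)) *
    Matrix.mvPolynomialX (Fin m) (Fin n) ℝ *
    V.map (algebraMap ℝ (MvPolynomial (Fin m × Fin n) ℝ))).det

theorem aeval_compressionDet {ι S : Type*} [Fintype ι] [DecidableEq ι] [CommRing S] [Algebra ℝ S]
    (U : Matrix ι (Fin m) ℝ) (V : Matrix (Fin n) ι ℝ) (a : Fin m × Fin n → S) :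
    MvPolynomial.aeval a (compressionDet U V) =
      (U.map (algebraMap ℝ S) * Matrix.of (fun i j => a (i, j)) * V.map (algebraMap ℝ S)).det := by
  rw [compressionDet, AlgHom.map_det, AlgHom.mapMatrix_apply, Matrix.map_mul, Matrix.map_mul,
    Matrix.map_map, Matrix.map_map]
  congr 3
  · congr 1
    ext
    simp
  · ext
    simp
  · ext
    simp

theorem eval_compressionDet {ι : Type*} [Fintype ι] [DecidableEq ι]
    (U : Matrix ι (Fin m) ℝ) (V : Matrix (Fin n) ι ℝ) (Y : Matrix (Fin m) (Fin n) ℝ) :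
    MvPolynomial.eval (fun p => Y p.1 p.2) (compressionDet U V) = (U * Y * V).det := by
  rw [← MvPolynomial.coe_aeval_eq_eval]
  exact aeval_compressionDet U V _

theorem eval_compressionDet_eq_zero_of_rank_lt {ι : Type*} [Fintype ι] [DecidableEq ι]
    (U : Matrix ι (Fin m) ℝ) (V : Matrix (Fin n) ι ℝ) {Y : Matrix (Fin m) (Fin n) ℝ}
    (hY : Y.rank < Fintype.card ι) :
    MvPolynomial.eval (fun p => Y p.1 p.2) (compressionDet U V) = 0 := by
  rw [eval_compressionDet]
  by_contra h
  have := Matrix.rank_of_isUnit _ ((Matrix.isUnit_iff_isUnit_det _).2 (isUnit_iff_ne_zero.2 h))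
  have := (Matrix.rank_mul_le_left (U * Y) V).trans (Matrix.rank_mul_le_right U Y)
  omega

/-- Expansion along a line through `X` of the determinant of a matrix whose compression at `X` is
an identity block bordered by zeros. -/
theorem exists_aeval_polyShift_compressionDet_eq {p q : ℕ}
    {U₁ : Matrix (Fin p) (Fin m) ℝ} {V₁ : Matrix (Fin n) (Fin p) ℝ}
    {U₂ : Matrix (Fin q) (Fin m) ℝ} {V₂ : Matrix (Fin n) (Fin q) ℝ}
    (h₁ : U₁ * X * V₁ = 1) (hU₂ : U₂ * X = 0) (hV₂ : X * V₂ = 0) (Z : Matrix (Fin m) (Fin n) ℝ) :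
    ∃ g : Polynomial ℝ, g.coeff 0 = (U₂ * Z * V₂).det ∧
      MvPolynomial.aeval (fun i => Polynomial.X * Polynomial.C (Z i.1 i.2))
        (polyShift X (compressionDet (Matrix.fromRows U₁ U₂) (Matrix.fromCols V₁ V₂))) =
      Polynomial.X ^ q * g := by
  let c : ℝ →+* Polynomial ℝ := Polynomial.C
  let T : Polynomial ℝ := Polynomial.X
  let M : Matrix (Fin p ⊕ Fin q) (Fin p ⊕ Fin q) (Polynomial ℝ) :=
    Matrix.fromBlocks (1 + T • (U₁ * Z * V₁).map c) (T • (U₁ * Z * V₂).map c)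
      ((U₂ * Z * V₁).map c) ((U₂ * Z * V₂).map c)
  refine ⟨M.det, ?_, ?_⟩
  · have hM : Polynomial.constantCoeff.mapMatrix M =
        Matrix.fromBlocks 1 0 (U₂ * Z * V₁) (U₂ * Z * V₂) := by
      rw [RingHom.mapMatrix_apply, Matrix.fromBlocks_map]
      congr 1
      · ext i j
        by_cases h : i = j <;> simp [T, c, Matrix.one_apply, h]
      all_goals
        ext i j
        simp [T, c, -Matrix.map_mul]
    rw [← Polynomial.constantCoeff_apply, RingHom.map_det, hM, Matrix.det_fromBlocks_zero₁₂,
      Matrix.det_one, one_mul]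
  · have hlin (k l : ℕ) (U : Matrix (Fin k) (Fin m) ℝ) (V : Matrix (Fin n) (Fin l) ℝ) :
        U.map c * (X.map c + T • Z.map c) * V.map c =
          (U * X * V).map c + T • (U * Z * V).map c := by
      simp only [Matrix.mul_add, Matrix.add_mul, Matrix.map_mul, Matrix.mul_smul, Matrix.smul_mul]
    have hfac : (Matrix.fromRows U₁ U₂).map c * (X.map c + T • Z.map c) *
        (Matrix.fromCols V₁ V₂).map c = Matrix.fromBlocks 1 0 0 (T • 1) * M := by
      have hrows : (Matrix.fromRows U₁ U₂).map c =
          Matrix.fromRows (U₁.map c) (U₂.map c) := by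
        ext (i | i) j <;> rfl
      have hcols : (Matrix.fromCols V₁ V₂).map c =
          Matrix.fromCols (V₁.map c) (V₂.map c) := by
        ext i (j | j) <;> rfl
      rw [hrows, hcols, Matrix.fromRows_mul, Matrix.fromRows_mul_fromCols,
        Matrix.fromBlocks_multiply]
      simp only [hlin, h₁, hU₂, Matrix.mul_assoc U₁ X V₂, hV₂]
      simp
    have hgen : Matrix.of (fun i j => Polynomial.X * Polynomial.C (Z i j) +
        algebraMap ℝ (Polynomial ℝ) (X i j)) = X.map c + T • Z.map c := by
      ext1 i j
      exact add_comm _ _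
    rw [aeval_polyShift, aeval_compressionDet]
    dsimp only
    rw [hgen]
    refine (congrArg Matrix.det hfac).trans ?_
    rw [Matrix.det_mul, Matrix.det_fromBlocks_zero₁₂, Matrix.det_one, one_mul, Matrix.det_smul,
      Matrix.det_one, mul_one, Fintype.card_fin]

theorem det_compression_eq_zero_of_mem_algTangentCone {r p q : ℕ} (hr : r < p + q)
    {U₁ : Matrix (Fin p) (Fin m) ℝ} {V₁ : Matrix (Fin n) (Fin p) ℝ}
    {U₂ : Matrix (Fin q) (Fin m) ℝ} {V₂ : Matrix (Fin n) (Fin q) ℝ}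
    (h₁ : U₁ * X * V₁ = 1) (hU₂ : U₂ * X = 0) (hV₂ : X * V₂ = 0) {Z : Matrix (Fin m) (Fin n) ℝ}
    (hZ : Z ∈ algTangentCone {Y : Matrix (Fin m) (Fin n) ℝ | Y.rank ≤ r} X) :
    (U₂ * Z * V₂).det = 0 := by
  let f := compressionDet (Matrix.fromRows U₁ U₂) (Matrix.fromCols V₁ V₂)
  have hf (Y : Matrix (Fin m) (Fin n) ℝ) (hY : Y.rank ≤ r) :
      MvPolynomial.eval (fun i : Fin m × Fin n => Y i.1 i.2) f = 0 := by
    apply eval_compressionDet_eq_zero_of_rank_lt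
    simpa using hY.trans_lt hr
  have hlow (j : ℕ) (hj : j < q) :
      MvPolynomial.homogeneousComponent j (polyShift X f) = 0 := by
    refine MvPolynomial.funext fun z => ?_
    obtain ⟨g, -, hg⟩ := exists_aeval_polyShift_compressionDet_eq h₁ hU₂ hV₂
      (Matrix.of fun i j => z (i, j))
    rw [map_zero, ← MvPolynomial.coeff_aeval_X_mul_C]
    refine (congrArg (Polynomial.coeff · j) hg).trans ?_
    rw [Polynomial.coeff_X_pow_mul', if_neg (by omega)]
  have hinit : MvPolynomial.eval (fun i : Fin m × Fin n => Z i.1 i.2)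
      (MvPolynomial.homogeneousComponent q (polyShift X f)) = (U₂ * Z * V₂).det := by
    obtain ⟨g, hg₀, hg⟩ := exists_aeval_polyShift_compressionDet_eq h₁ hU₂ hV₂ Z
    rw [← MvPolynomial.coeff_aeval_X_mul_C, hg, Polynomial.coeff_X_pow_mul', if_pos le_rfl,
      Nat.sub_self, hg₀]
  by_contra hdet
  rw [← hinit] at hdet
  exact hdet <| hZ f hf q hlow fun h => hdet <| by rw [h, map_zero]

end TangentCone

/-- the algebraic tangent cone to `ℝ_{≤r}^{m×n}` at `X` equals
`{Z : rank (Pᵀ Z Q) ≤ r - rank X}`, where `P` and `Q` have full column rank with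
column spaces `ker Xᵀ` and `ker X`. -/
theorem algTangentCone_rank_le
    {m n r : ℕ} (hr : r < min m n)
    (X : Matrix (Fin m) (Fin n) ℝ) (hX : X.rank ≤ r)
    (P : Matrix (Fin m) (Fin (m - X.rank)) ℝ)
    (Q : Matrix (Fin n) (Fin (n - X.rank)) ℝ)
    (hP : P.rank = m - X.rank) (hQ : Q.rank = n - X.rank)
    (hPc : LinearMap.range P.mulVecLin = LinearMap.ker Xᵀ.mulVecLin)
    (hQc : LinearMap.range Q.mulVecLin = LinearMap.ker X.mulVecLin) :
    algTangentCone {Y : Matrix (Fin m) (Fin n) ℝ | Y.rank ≤ r} X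
      = {Z : Matrix (Fin m) (Fin n) ℝ | (Pᵀ * Z * Q).rank ≤ r - X.rank} := by
  ext Z
  constructor
  · intro hZ
    by_contra hrank
    have hq : r - X.rank + 1 ≤ (Pᵀ * Z * Q).rank := Nat.lt_of_not_le hrank
    obtain ⟨U₁, V₁, h₁⟩ := Matrix.exists_mul_mul_eq_one_of_le_rank le_rfl (D := X)
    obtain ⟨U, V, hUV⟩ := Matrix.exists_mul_mul_eq_one_of_le_rank hq
    have hPX : Pᵀ * X = 0 := by
      have := Matrix.mul_eq_zero_of_range_mulVecLin_le_ker hPc.le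
      rw [← Matrix.transpose_eq_zero, Matrix.transpose_mul, Matrix.transpose_transpose, this]
    have hXQ : X * Q = 0 := Matrix.mul_eq_zero_of_range_mulVecLin_le_ker hQc.le
    have hdet := det_compression_eq_zero_of_mem_algTangentCone (U₂ := U * Pᵀ) (V₂ := Q * V)
      (by omega) h₁ (by rw [Matrix.mul_assoc, hPX, Matrix.mul_zero])
      (by rw [← Matrix.mul_assoc, hXQ, Matrix.zero_mul]) hZ
    have heq : U * Pᵀ * Z * (Q * V) = 1 := by
      rw [← hUV]
      simp only [Matrix.mul_assoc]
    rw [heq, Matrix.det_one] at hdet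
    exact one_ne_zero hdet
  · intro hZ
    obtain ⟨L, R, E, hE, hErank⟩ :=
      Matrix.exists_eq_mul_add_mul_add_of_range_eq_ker hPc hQc Z
    apply mem_algTangentCone_of_forall_add_mem (W := L * X * R)
    intro t
    have heq : X + t • (Z + t • (L * X * R)) = (1 + t • L) * X * (1 + t • R) + t • E := by
      simp only [hE, Matrix.add_mul, Matrix.mul_add, Matrix.one_mul, Matrix.mul_one,
        Matrix.smul_mul, Matrix.mul_smul, smul_add]
      abel
    have hrank₁ : ((1 + t • L) * X * (1 + t • R)).rank ≤ X.rank :=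
      (Matrix.rank_mul_le_left _ _).trans (Matrix.rank_mul_le_right _ _)
    have hrank₂ : (t • E).rank ≤ E.rank := by
      rw [← Matrix.one_mul E, ← Matrix.smul_mul, Matrix.one_mul]
      exact Matrix.rank_mul_le_right _ _
    have hrank₃ := Matrix.rank_add_le_rank_add_rank_s9 ((1 + t • L) * X * (1 + t • R)) (t • E)
    have hZ' : (Pᵀ * Z * Q).rank ≤ r - X.rank := hZ
    rw [Set.mem_ofPred_eq, heq]
    omega
end

section
/- Let m, n ∈ ℕ, let X ∈ ℝ^{m×n} with rank X = r̲, and let (L_i) be a sequence in ℝ^{m×n} with rank L_i = r̲ for every i, converging to X. Then there exists N ∈ ℕ such that for every i ≥ N, the column space of L_i intersects the orthogonal complement of the column space of X only in {0}, and the column space of L_iᵀ intersects the orthogonal complement of the column space of Xᵀ only in {0}. -/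
open Matrix

theorem Matrix.isOpen_setOf_le_rank {m n : Type*} [Fintype m] [Fintype n] (k : ℕ) :
    IsOpen {A : Matrix m n ℝ | k ≤ A.rank} := by
  classical
  let f : Matrix m n ℝ →ₗ[ℝ] ((n → ℝ) →L[ℝ] (m → ℝ)) :=
    (LinearMap.toContinuousLinearMap.toLinearMap).comp (Matrix.toLin' (R := ℝ)).toLinearMap
  have hf : Continuous f := f.continuous_of_finiteDimensional
  convert (isOpen_setOfPred_nat_le_rank (𝕜 := ℝ) (E := n → ℝ) (F := m → ℝ) k).preimage hf using 1
  ext A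
  change k ≤ Module.finrank ℝ (LinearMap.range A.mulVecLin) ↔
    (k : Cardinal) ≤ Module.rank ℝ (LinearMap.range (Matrix.toLin' A))
  rw [Matrix.toLin'_apply', ← Module.finrank_eq_rank, Nat.cast_le]

theorem Matrix.mulVec_eq_zero_of_rank_le_rank_mul {l m n : Type*} [Fintype l] [Fintype m]
    [Fintype n] {B : Matrix l m ℝ} {A : Matrix m n ℝ} (h : A.rank ≤ (B * A).rank)
    {v : n → ℝ} (hv : (B * A) *ᵥ v = 0) : A *ᵥ v = 0 := by
  have hle : LinearMap.ker A.mulVecLin ≤ LinearMap.ker (B * A).mulVecLin := by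
    rw [Matrix.mulVecLin_mul]
    exact LinearMap.ker_le_ker_comp _ _
  have hA := A.mulVecLin.finrank_range_add_finrank_ker
  have hBA := (B * A).mulVecLin.finrank_range_add_finrank_ker
  have heq := Submodule.eq_of_le_of_finrank_le hle (by unfold Matrix.rank at h; omega)
  have hmem : v ∈ LinearMap.ker A.mulVecLin := by
    rw [heq]
    exact hv
  exact hmem

theorem colSpace_inf_orthogonal_eq_bot_of_rank_le {m n : ℕ} {X A : Matrix (Fin m) (Fin n) ℝ}
    (h : A.rank ≤ (Xᵀ * A).rank) : colSpace A ⊓ (colSpace X)ᗮ = ⊥ := by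
  rw [eq_bot_iff]
  rintro _ ⟨⟨v, rfl⟩, hv⟩
  have hX : Xᵀ *ᵥ (A *ᵥ v.ofLp) = 0 := by
    refine dotProduct_eq_zero _ fun w => ?_
    have hw := (Submodule.mem_orthogonal _ _).1 hv _ ⟨WithLp.toLp 2 w, rfl⟩
    rw [EuclideanSpace.inner_eq_star_dotProduct] at hw
    rw [Matrix.mulVec_transpose]
    simpa [Matrix.ofLp_toLpLin, Matrix.dotProduct_mulVec] using hw
  have hA := Matrix.mulVec_eq_zero_of_rank_le_rank_mul h (v := v.ofLp) (by
    rw [← Matrix.mulVec_mulVec, hX])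
  rw [Submodule.mem_bot]
  ext i
  exact congrFun hA i

theorem eventually_colSpace_inf_orthogonal_eq_bot_of_rank_eq {m n : ℕ}
    {X : Matrix (Fin m) (Fin n) ℝ} {L : ℕ → Matrix (Fin m) (Fin n) ℝ}
    (hrank : ∀ i, (L i).rank = X.rank) (hconv : Filter.Tendsto L Filter.atTop (nhds X)) :
    ∀ᶠ i in Filter.atTop, colSpace (L i) ⊓ (colSpace X)ᗮ = ⊥ := by
  have hmul : Filter.Tendsto (fun i => Xᵀ * L i) Filter.atTop (nhds (Xᵀ * X)) :=
    ((continuous_const.matrix_mul continuous_id).tendsto X).comp hconv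
  filter_upwards [hmul.eventually ((Matrix.isOpen_setOf_le_rank X.rank).mem_nhds
    (Matrix.rank_transpose_mul_self X).ge)] with i hi
  exact colSpace_inf_orthogonal_eq_bot_of_rank_le ((hrank i).trans_le hi)

/-- if `L_i → X` with `rank L_i = rank X` for all `i`, then eventually the
column space of `L_i` meets `(im X)ᗮ` trivially and the column space of `L_iᵀ` meets
`(im Xᵀ)ᗮ` trivially. -/
theorem eventually_colSpace_inf_orthogonal_eq_bot
    {m n : ℕ} (X : Matrix (Fin m) (Fin n) ℝ)
    (L : ℕ → Matrix (Fin m) (Fin n) ℝ)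
    (hrank : ∀ i, (L i).rank = X.rank)
    (hconv : Filter.Tendsto L Filter.atTop (nhds X)) :
    ∃ N : ℕ, ∀ i ≥ N,
      colSpace (L i) ⊓ (colSpace X)ᗮ = ⊥ ∧
      colSpace (L i)ᵀ ⊓ (colSpace Xᵀ)ᗮ = ⊥ := by
  have hcol := eventually_colSpace_inf_orthogonal_eq_bot_of_rank_eq hrank hconv
  have hrow := eventually_colSpace_inf_orthogonal_eq_bot_of_rank_eq (X := Xᵀ)
    (L := fun i => (L i)ᵀ) (fun i => by simp only [Matrix.rank_transpose, hrank])
    ((continuous_id.matrix_transpose.tendsto X).comp hconv)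
  exact Filter.eventually_atTop.1 (hcol.and hrow)
end

section
/- Let m, n, r ∈ ℕ, let X ∈ ℝ^{m×n} with rank X = r̲ ≤ r, and let L, W ∈ ℝ^{m×n} satisfy: rank L = r̲; the column space of L intersects the orthogonal complement of the column space of X only in {0}; the column space of Lᵀ intersects the orthogonal complement of the column space of Xᵀ only in {0}; the column space of W is contained in the orthogonal complement of the column space of X; the column space of Wᵀ is contained in the orthogonal complement of the column space of Xᵀ; and rank(L + W) ≤ r. Then rank W ≤ r − r̲. -/
open Matrix

/-- If the kernels of two linear maps span the domain, then the range of their sum contains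
the range of the first. -/
theorem LinearMap.range_le_range_add_of_codisjoint_ker {K V U : Type*} [Ring K]
    [AddCommGroup V] [Module K V] [AddCommGroup U] [Module K U] {f g : V →ₗ[K] U}
    (h : Codisjoint (LinearMap.ker f) (LinearMap.ker g)) :
    LinearMap.range f ≤ LinearMap.range (f + g) := by
  rintro _ ⟨x, rfl⟩
  obtain ⟨a, ha, b, hb, rfl⟩ := Submodule.mem_sup.mp (h.eq_top ▸ Submodule.mem_top (x := x))
  rw [LinearMap.mem_ker] at ha hb
  exact ⟨b, by simp [ha, hb]⟩

/-- Rank is superadditive on linear maps with disjoint ranges and codisjoint kernels. -/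
theorem LinearMap.finrank_range_add_finrank_range_le {K V U : Type*} [DivisionRing K]
    [AddCommGroup V] [Module K V] [AddCommGroup U] [Module K U] [FiniteDimensional K U]
    {f g : V →ₗ[K] U} (hr : Disjoint (LinearMap.range f) (LinearMap.range g))
    (hk : Codisjoint (LinearMap.ker f) (LinearMap.ker g)) :
    Module.finrank K (LinearMap.range f) + Module.finrank K (LinearMap.range g) ≤
      Module.finrank K (LinearMap.range (f + g)) := by
  rw [← Submodule.finrank_sup_add_finrank_inf_eq, hr.eq_bot, finrank_bot, add_zero]
  refine Submodule.finrank_mono (sup_le (range_le_range_add_of_codisjoint_ker hk) ?_)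
  rw [add_comm f g]
  exact range_le_range_add_of_codisjoint_ker hk.symm

theorem finrank_colSpace {m n : ℕ} (A : Matrix (Fin m) (Fin n) ℝ) :
    Module.finrank ℝ (colSpace A) = A.rank := by
  rw [colSpace, Matrix.toEuclideanLin_eq_toLin_orthonormal]
  exact (A.rank_eq_finrank_range_toLin _ _).symm

theorem orthogonal_ker_toEuclideanLin {m n : ℕ} (A : Matrix (Fin m) (Fin n) ℝ) :
    (LinearMap.ker (Matrix.toEuclideanLin A))ᗮ = colSpace Aᵀ := by
  rw [colSpace, ← Matrix.conjTranspose_eq_transpose_of_trivial,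
    Matrix.toEuclideanLin_conjTranspose_eq_adjoint, LinearMap.orthogonal_ker]

/-- if `rank L = rank X ≤ r`, the column spaces of `L` and `Lᵀ` meet
`(im X)ᗮ` and `(im Xᵀ)ᗮ` trivially, the column spaces of `W` and `Wᵀ` are contained in
`(im X)ᗮ` and `(im Xᵀ)ᗮ`, and `rank (L + W) ≤ r`, then `rank W ≤ r - rank X`. -/
theorem rank_normal_part_le
    {m n r : ℕ} (X L W : Matrix (Fin m) (Fin n) ℝ)
    (hXr : X.rank ≤ r) (hL : L.rank = X.rank)
    (hL₁ : colSpace L ⊓ (colSpace X)ᗮ = ⊥)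
    (hL₂ : colSpace Lᵀ ⊓ (colSpace Xᵀ)ᗮ = ⊥)
    (hW₁ : colSpace W ≤ (colSpace X)ᗮ)
    (hW₂ : colSpace Wᵀ ≤ (colSpace Xᵀ)ᗮ)
    (hLW : (L + W).rank ≤ r) :
    W.rank ≤ r - X.rank := by
  have hr : Disjoint (colSpace L) (colSpace W) :=
    (disjoint_iff.mpr hL₁).mono_right hW₁
  have ht : Disjoint (colSpace Lᵀ) (colSpace Wᵀ) :=
    (disjoint_iff.mpr hL₂).mono_right hW₂
  have hk : Codisjoint (LinearMap.ker (Matrix.toEuclideanLin L))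
      (LinearMap.ker (Matrix.toEuclideanLin W)) := by
    rw [codisjoint_iff, ← Submodule.orthogonal_eq_bot_iff, ← Submodule.inf_orthogonal,
      orthogonal_ker_toEuclideanLin, orthogonal_ker_toEuclideanLin, ht.eq_bot]
  have h : L.rank + W.rank ≤ (L + W).rank := by
    rw [← finrank_colSpace, ← finrank_colSpace, ← finrank_colSpace, colSpace, colSpace, colSpace,
      map_add]
    exact LinearMap.finrank_range_add_finrank_range_le hr hk
  omega
end
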